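/- There is an absolute constant C with the following property. Let k ∈ ℂ⁺ and let f ∈ C_c^∞(ℝ³ ∖ {0}; ℂ³) be a smooth vector field whose compact support avoids the origin. For r > 0 and σ ∈ S² define μ₁(r,σ) := r ∫_{ℝ³} [e^{ik(−r+|rσ−y|+|y|)} / (4π |rσ−y| |y|)] · ( |y|² div_y(f(y)/|y|) ) dy. Then sup_{r>0} ∫_r^{r+1} ‖μ₁(ρ,·)‖²_{L²(S²)} dρ ≤ C ( 1/|k|² + 1/(Im k)² + 1/(Im k) ) ‖f‖²_{L²(ℝ³)}. -/

import Mathlib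

open MeasureTheory Metric

noncomputable section

/-- The kernel `e^{ik(−r+|rσ−y|+|y|)} / (4π |rσ−y| |y|)`. -/
def ker (k : ℂ) (r : ℝ) (σ y : EuclideanSpace ℝ (Fin 3)) : ℂ :=
  Complex.exp (Complex.I * k * ((-r + ‖r • σ - y‖ + ‖y‖ : ℝ) : ℂ)) /
    ((4 * Real.pi * ‖r • σ - y‖ * ‖y‖ : ℝ) : ℂ)

/-- Divergence of a `ℂ³`-valued vector field on `ℝ³`. -/
def cdiv (g : EuclideanSpace ℝ (Fin 3) → EuclideanSpace ℂ (Fin 3))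
    (y : EuclideanSpace ℝ (Fin 3)) : ℂ :=
  ∑ i : Fin 3, fderiv ℝ (fun z => g z i) y (EuclideanSpace.single i 1)

/-- `μ₁(r,σ) = r ∫ ker(k,r,σ,y) · (|y|² div(f/|y|))(y) dy`. -/
def mu1 (k : ℂ) (f : EuclideanSpace ℝ (Fin 3) → EuclideanSpace ℂ (Fin 3))
    (r : ℝ) (σ : EuclideanSpace ℝ (Fin 3)) : ℂ :=
  (r : ℂ) * ∫ y : EuclideanSpace ℝ (Fin 3),
    ker k r σ y * (((‖y‖ : ℝ) : ℂ) ^ 2 * cdiv (fun z => ‖z‖⁻¹ • f z) y)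

end

section

open MeasureTheory Metric
open scoped Pointwise

/-! ### Comparison of the Hausdorff measure on the sphere with the cone measure -/

abbrev E3 := EuclideanSpace ℝ (Fin 3)

lemma norm_normalize_sub_le {a b : E3} (ha : 1 ≤ ‖a‖) (hb : 1 ≤ ‖b‖) :
    ‖‖a‖⁻¹ • a - ‖b‖⁻¹ • b‖ ≤ 2 * ‖a - b‖ := by
  have ha0 : 0 < ‖a‖ := by linarith
  have hb0 : 0 < ‖b‖ := by linarith
  have e : ‖a‖⁻¹ • a - ‖b‖⁻¹ • b = ‖a‖⁻¹ • ((a - b) + (‖b‖ - ‖a‖) • (‖b‖⁻¹ • b)) := by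
    have : ‖a‖⁻¹ * ((‖b‖ - ‖a‖) * ‖b‖⁻¹) = ‖a‖⁻¹ - ‖b‖⁻¹ := by field_simp
    rw [smul_add, smul_smul (‖b‖ - ‖a‖), smul_smul ‖a‖⁻¹]
    rw [this]
    module
  rw [e, norm_smul, norm_inv, norm_norm]
  have h1 : ‖(a - b) + (‖b‖ - ‖a‖) • (‖b‖⁻¹ • b)‖ ≤ 2 * ‖a - b‖ := by
    refine (norm_add_le _ _).trans ?_
    rw [norm_smul, norm_smul, norm_inv, norm_norm, inv_mul_cancel₀ hb0.ne', mul_one]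
    have := abs_norm_sub_norm_le b a
    rw [norm_sub_rev] at this
    rw [Real.norm_eq_abs]; linarith
  calc ‖a‖⁻¹ * _ ≤ 1 * (2 * ‖a - b‖) := by
        gcongr
        exact inv_le_one_of_one_le₀ ha
    _ = _ := one_mul _

/-- The affine chart `p ↦ (p with s inserted at the i-th place)`. -/
noncomputable def chartN (i : Fin 3) (s : ℝ) (p : Fin 2 → ℝ) : E3 :=
  WithLp.toLp 2 (i.insertNth s p : Fin 3 → ℝ)

lemma chartN_norm_sq (i : Fin 3) (s : ℝ) (p : Fin 2 → ℝ) :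
    ‖chartN i s p‖ ^ 2 = s ^ 2 + (p 0 ^ 2 + p 1 ^ 2) := by
  rw [EuclideanSpace.norm_sq_eq, Fin.sum_univ_succAbove _ i]
  simp [chartN, Fin.sum_univ_two]

lemma chartN_sub (i : Fin 3) (s : ℝ) (p q : Fin 2 → ℝ) :
    chartN i s p - chartN i s q = chartN i 0 (p - q) := by
  ext j
  refine Fin.succAboveCases i ?_ ?_ j <;> simp [chartN]

lemma chartN_smul (i : Fin 3) (s t : ℝ) (p : Fin 2 → ℝ) :
    t • chartN i s p = chartN i (t * s) (t • p) := by
  ext j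
  refine Fin.succAboveCases i ?_ ?_ j <;> simp [chartN]

lemma chartN_one_le (i : Fin 3) {s : ℝ} (hs : s ^ 2 = 1) (p : Fin 2 → ℝ) :
    1 ≤ ‖chartN i s p‖ := by
  have := chartN_norm_sq i s p
  have h0 := norm_nonneg (chartN i s p)
  nlinarith [sq_nonneg (p 0), sq_nonneg (p 1)]

noncomputable def chartG (i : Fin 3) (s : ℝ) (p : Fin 2 → ℝ) : E3 :=
  ‖chartN i s p‖⁻¹ • chartN i s p

lemma chartG_lip (i : Fin 3) {s : ℝ} (hs : s ^ 2 = 1) : LipschitzWith 4 (chartG i s) := by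
  refine LipschitzWith.of_dist_le_mul fun p q => ?_
  rw [dist_eq_norm, dist_eq_norm]
  refine (norm_normalize_sub_le (chartN_one_le i hs p) (chartN_one_le i hs q)).trans ?_
  rw [chartN_sub]
  have h := chartN_norm_sq i 0 (p - q)
  have h0 := norm_le_pi_norm (p - q) 0
  have h1 := norm_le_pi_norm (p - q) 1
  have h2 : ‖chartN i 0 (p - q)‖ ≤ 2 * ‖p - q‖ := by
    refine abs_le_of_sq_le_sq' ?_ (by positivity) |>.2
    rw [h]
    have a0 : (p - q) 0 ^ 2 ≤ ‖p - q‖ ^ 2 := by rw [← sq_abs]; gcongr; exact h0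
    have a1 : (p - q) 1 ^ 2 ≤ ‖p - q‖ ^ 2 := by rw [← sq_abs]; gcongr; exact h1
    nlinarith [sq_nonneg ‖p - q‖]
  simp only [NNReal.coe_ofNat]
  linarith

lemma chartN_meas (i : Fin 3) : Measurable (fun z : ℝ × (Fin 2 → ℝ) => chartN i z.1 z.2) := by
  have h1 : Measurable (fun z : ℝ × (Fin 2 → ℝ) => (MeasurableEquiv.piFinSuccAbove (fun _ => ℝ) i).symm z) :=
    MeasurableEquiv.measurable _
  exact (WithLp.measurable_toLp 2 _).comp h1

lemma chartN_mp (i : Fin 3) : MeasurePreserving (fun z : ℝ × (Fin 2 → ℝ) => chartN i z.1 z.2) := by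
  have h1 := (volume_preserving_piFinSuccAbove (fun _ : Fin 3 => ℝ) i).symm
  exact (PiLp.volume_preserving_toLp (Fin 3)).comp h1

lemma cone_lower (i : Fin 3) {s : ℝ} (hs : s ^ 2 = 1) (A : Set E3) (hA : MeasurableSet A) 
    (A' : Set (Fin 2 → ℝ)) (hA' : MeasurableSet A') (hb : ∀ p ∈ A', ‖p‖ ≤ 2)
    (hg : ∀ p ∈ A', chartG i s p ∈ A) :
    volume A' ≤ 192 * volume {y : E3 | 0 < ‖y‖ ∧ ‖y‖ < 1 ∧ ‖y‖⁻¹ • y ∈ A} := by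
  set S : Set E3 := {y : E3 | 0 < ‖y‖ ∧ ‖y‖ < 1 ∧ ‖y‖⁻¹ • y ∈ A} with hS
  have hSm : MeasurableSet S := by
    have : Measurable (fun y : E3 => ‖y‖⁻¹ • y) := by fun_prop
    have h2 : Measurable (fun y : E3 => ‖y‖) := by fun_prop
    exact (measurableSet_lt measurable_const h2).inter 
      ((measurableSet_lt h2 measurable_const).inter (this hA))
  have hss : s * s = 1 := by rw [← sq]; exact hs
  rw [← (chartN_mp i).measure_preimage hSm.nullMeasurableSet]
  rw [Measure.volume_eq_prod, Measure.prod_apply ((chartN_mp i).measurable hSm)]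
  have key : ∀ t ∈ Set.Ioo (0:ℝ) (1/4), ENNReal.ofReal (t ^ 2) * volume A' ≤ 
      volume (Prod.mk (s * t) ⁻¹' ((fun z : ℝ × (Fin 2 → ℝ) => chartN i z.1 z.2) ⁻¹' S)) := by
    intro t ht
    have e1 : volume (t • A') = ENNReal.ofReal (t ^ 2) * volume A' := by
      rw [Measure.addHaar_smul]
      simp
    rw [← e1]
    apply measure_mono
    rintro _ ⟨p, hp, rfl⟩
    have h1 : chartN i (s * t) (t • p) = t • chartN i s p := by rw [chartN_smul, mul_comm]
    simp only [Set.mem_preimage]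
    rw [h1]
    have hN := chartN_one_le i hs p
    have hn : ‖t • chartN i s p‖ = t * ‖chartN i s p‖ := by
      rw [norm_smul, Real.norm_eq_abs, abs_of_pos ht.1]
    have hN3 : ‖chartN i s p‖ ≤ 3 := by
      have h := chartN_norm_sq i s p
      refine abs_le_of_sq_le_sq' ?_ (by positivity) |>.2
      rw [h, hs]
      have a0 : p 0 ^ 2 ≤ 2 ^ 2 := by 
        rw [← sq_abs]; gcongr; exact (norm_le_pi_norm p 0).trans (hb p hp)
      have a1 : p 1 ^ 2 ≤ 2 ^ 2 := by 
        rw [← sq_abs]; gcongr; exact (norm_le_pi_norm p 1).trans (hb p hp)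
      linarith
    refine ⟨?_, ?_, ?_⟩
    · rw [hn]; have := ht.1; positivity
    · rw [hn]; nlinarith [ht.1, ht.2]
    · rw [hn, smul_smul]
      have : (t * ‖chartN i s p‖)⁻¹ * t = ‖chartN i s p‖⁻¹ := by
        have := ht.1
        field_simp
      rw [this]; exact hg p hp
  set Ψ := fun τ : ℝ => volume (Prod.mk τ ⁻¹' ((fun z : ℝ × (Fin 2 → ℝ) => chartN i z.1 z.2) ⁻¹' S)) with hΨ
  have hsub : ∫⁻ t : ℝ, Ψ (s * t) = ∫⁻ τ : ℝ, Ψ τ := by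
    have hs1 : s = 1 ∨ s = -1 := mul_self_eq_one_iff.mp hss
    rcases hs1 with rfl | rfl
    · simp
    · simp only [neg_mul, one_mul]; exact lintegral_neg_eq_self Ψ
  rw [← hsub]
  have hlow : ENNReal.ofReal (1/192) * volume A' ≤ ∫⁻ t : ℝ, Ψ (s * t) := by
    calc ENNReal.ofReal (1/192) * volume A' 
        = (∫⁻ t in Set.Ioo (0:ℝ) (1/4), ENNReal.ofReal (t ^ 2)) * volume A' := by
          congr 1
          rw [restrict_Ioo_eq_restrict_Ioc, ← ofReal_integral_eq_lintegral_ofReal]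
          · rw [← intervalIntegral.integral_of_le (by norm_num), integral_pow]; norm_num
          · exact (continuous_pow 2).integrableOn_Ioc
          · filter_upwards with x; positivity
      _ = ∫⁻ t in Set.Ioo (0:ℝ) (1/4), ENNReal.ofReal (t ^ 2) * volume A' := by
          rw [lintegral_mul_const]; fun_prop
      _ ≤ ∫⁻ t in Set.Ioo (0:ℝ) (1/4), Ψ (s * t) := setLIntegral_mono' measurableSet_Ioo key
      _ ≤ _ := setLIntegral_le_lintegral _ _
  calc volume A' = 192 * (ENNReal.ofReal (1/192) * volume A') := by
        rw [← mul_assoc]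
        have : (192 : ENNReal) * ENNReal.ofReal (1/192) = 1 := by
          rw [show (192:ENNReal) = ENNReal.ofReal 192 by simp, ← ENNReal.ofReal_mul (by norm_num)]
          norm_num
        rw [this, one_mul]
    _ ≤ _ := by gcongr

lemma patch_bound (i : Fin 3) {s : ℝ} (hs : s ^ 2 = 1) (A : Set E3) (hA : MeasurableSet A) :
    μH[2] (A ∩ sphere 0 1 ∩ {x | 1/2 ≤ s * x i}) ≤ 
      (16 * 192) * volume {y : E3 | 0 < ‖y‖ ∧ ‖y‖ < 1 ∧ ‖y‖⁻¹ • y ∈ A} := by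
  set A' : Set (Fin 2 → ℝ) := {p | ‖p‖ ≤ 2} ∩ chartG i s ⁻¹' A with hA'
  have hA'm : MeasurableSet A' := 
    (measurableSet_le (by fun_prop) measurable_const).inter ((chartG_lip i hs).continuous.measurable hA)
  have hss : s * s = 1 := by rw [← sq]; exact hs
  have hsub : A ∩ sphere 0 1 ∩ {x | 1/2 ≤ s * x i} ⊆ chartG i s '' A' := by
    rintro x ⟨⟨hxA, hxS⟩, hx⟩
    simp only [Set.mem_ofPred_eq] at hx
    have hxn : ‖x‖ = 1 := by simpa using hxS
    set c := s * x i with hc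
    have hc0 : 0 < c := by linarith
    set p : Fin 2 → ℝ := fun j => c⁻¹ * x (i.succAbove j) with hp
    have e1 : chartN i s p = c⁻¹ • x := by
      ext j
      refine Fin.succAboveCases i ?_ ?_ j
      · simp only [chartN, Fin.insertNth_apply_same, PiLp.smul_apply, smul_eq_mul]
        rw [eq_inv_mul_iff_mul_eq₀ hc0.ne', hc]
        linear_combination (x i) * hss
      · intro j
        simp [chartN, hp]
    have e2 : chartG i s p = x := by
      rw [chartG, e1, norm_smul, hxn, smul_smul, norm_inv, Real.norm_eq_abs, abs_of_pos hc0]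
      simp [hc0.ne']
    refine ⟨p, ⟨?_, ?_⟩, e2⟩
    · simp only [Set.mem_ofPred_eq]
      rw [pi_norm_le_iff_of_nonneg (by norm_num)]
      intro j
      simp only [hp, norm_mul, norm_inv, Real.norm_eq_abs, abs_of_pos hc0]
      have h1 : |x (i.succAbove j)| ≤ 1 := by
        have := PiLp.norm_apply_le x (i.succAbove j)
        rw [hxn] at this; exact this
      rw [inv_mul_le_iff₀ hc0]; linarith
    · simp only [Set.mem_preimage, e2]; exact hxA
  calc μH[2] (A ∩ sphere 0 1 ∩ {x | 1/2 ≤ s * x i}) ≤ μH[2] (chartG i s '' A') := measure_mono hsub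
    _ ≤ ((4 : NNReal) : ENNReal) ^ (2:ℝ) * μH[2] A' := 
        (chartG_lip i hs).hausdorffMeasure_image_le (by norm_num) A'
    _ = 16 * volume A' := by
        congr 1
        · norm_num
        · have := hausdorffMeasure_pi_real (ι := Fin 2)
          rw [Fintype.card_fin] at this
          rw [← this]; norm_num
    _ ≤ 16 * (192 * volume {y : E3 | 0 < ‖y‖ ∧ ‖y‖ < 1 ∧ ‖y‖⁻¹ • y ∈ A}) := by
        gcongr
        exact cone_lower i hs A hA A' hA'm (fun p hp => hp.1) (fun p hp => hp.2)
    _ = _ := by rw [mul_assoc]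

lemma sphere_bound (A : Set E3) (hA : MeasurableSet A) :
    μH[2] (A ∩ sphere 0 1) ≤ 
      (6 * (16 * 192)) * volume {y : E3 | 0 < ‖y‖ ∧ ‖y‖ < 1 ∧ ‖y‖⁻¹ • y ∈ A} := by
  have hcov : A ∩ sphere 0 1 ⊆ ⋃ i : Fin 3, ((A ∩ sphere 0 1 ∩ {x | 1/2 ≤ (1:ℝ) * x i}) ∪ 
      (A ∩ sphere 0 1 ∩ {x | 1/2 ≤ (-1:ℝ) * x i})) := by
    rintro x ⟨hxA, hx⟩
    have hxn : ‖x‖ = 1 := by simpa using hx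
    by_contra hcon
    simp only [Set.mem_iUnion, Set.mem_union, Set.mem_inter_iff, Set.mem_ofPred_eq, not_exists, 
      not_or, hxA, hx, true_and, not_le] at hcon
    have h := EuclideanSpace.norm_sq_eq x
    rw [hxn, Fin.sum_univ_three] at h
    have hb : ∀ i, ‖x i‖ ^ 2 ≤ 1/4 := fun i => by
      rw [Real.norm_eq_abs, sq_abs]
      have := hcon i
      nlinarith [this.1, this.2]
    linarith [hb 0, hb 1, hb 2]
  refine (measure_mono hcov).trans ((measure_iUnion_le _).trans ?_)
  set V := volume {y : E3 | 0 < ‖y‖ ∧ ‖y‖ < 1 ∧ ‖y‖⁻¹ • y ∈ A}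
  calc ∑' i : Fin 3, μH[2] ((A ∩ sphere 0 1 ∩ {x | 1/2 ≤ (1:ℝ) * x i}) ∪ 
      (A ∩ sphere 0 1 ∩ {x | 1/2 ≤ (-1:ℝ) * x i})) ≤ ∑' i : Fin 3, ((16 * 192) * V + (16 * 192) * V) := by
        gcongr with i
        exact (measure_union_le _ _).trans (add_le_add (patch_bound i (by norm_num) A hA) 
          (patch_bound i (by norm_num) A hA))
    _ = _ := by
      rw [tsum_fintype, Fin.sum_univ_three]; ring

lemma hausdorff_le : ((μH[2] : Measure E3).restrict (sphere 0 1)) ≤ 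
    ((6 * (16 * 192) : ENNReal)) • ((volume : Measure E3).toSphere.map (↑)) := by
  refine Measure.le_iff.2 fun A hA => ?_
  rw [Measure.restrict_apply hA, Measure.smul_apply, Measure.map_apply measurable_subtype_coe hA,
    Measure.toSphere_apply' _ (measurable_subtype_coe hA), smul_eq_mul]
  refine (sphere_bound A hA).trans ?_
  gcongr
  calc volume {y : E3 | 0 < ‖y‖ ∧ ‖y‖ < 1 ∧ ‖y‖⁻¹ • y ∈ A} 
      ≤ volume (Set.Ioo (0:ℝ) 1 • ((Subtype.val : sphere (0:E3) 1 → E3) '' (Subtype.val ⁻¹' A))) := by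
        apply measure_mono
        rintro y ⟨h0, h1, hy⟩
        refine ⟨‖y‖, ⟨h0, h1⟩, ‖y‖⁻¹ • y, ⟨⟨‖y‖⁻¹ • y, ?_⟩, hy, rfl⟩, ?_⟩
        · simp [norm_smul, h0.ne']
        · simp [smul_smul, h0.ne']
    _ ≤ _ := by
        conv_lhs => rw [← one_mul (volume _)]
        gcongr
        simp

end

section

open MeasureTheory Metric
open scoped Pointwise

/-! ### Polar coordinates -/

lemma finrank_E3 : Module.finrank ℝ E3 = 3 := by simp

lemma polar_mp : MeasurePreserving (homeomorphUnitSphereProd E3) 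
    ((volume : Measure E3).comap (↑)) 
    ((volume : Measure E3).toSphere.prod (Measure.volumeIoiPow 2)) := by
  have := (volume : Measure E3).measurePreserving_homeomorphUnitSphereProd
  rw [finrank_E3] at this
  exact this

lemma polar_mp_symm : MeasurePreserving (homeomorphUnitSphereProd E3).symm
    ((volume : Measure E3).toSphere.prod (Measure.volumeIoiPow 2))
    ((volume : Measure E3).comap (↑)) :=
  MeasurePreserving.symm (homeomorphUnitSphereProd E3).toMeasurableEquiv polar_mp

lemma polar_lintegral (q : E3 → ENNReal) (hq : Measurable q) :
    ∫⁻ x, q x = ∫⁻ σ : sphere (0 : E3) 1, (∫⁻ s in Set.Ioi (0:ℝ), ENNReal.ofReal (s ^ 2) * q (s • (σ : E3))) 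
      ∂((volume : Measure E3).toSphere) := by
  calc ∫⁻ x, q x = ∫⁻ x : ({(0 : E3)}ᶜ : Set E3), q x ∂((volume : Measure E3).comap (↑)) := by
        rw [lintegral_subtype_comap (measurableSet_singleton _).compl, restrict_compl_singleton]
    _ = ∫⁻ z, q ((homeomorphUnitSphereProd E3).symm z) 
          ∂((volume : Measure E3).toSphere.prod (Measure.volumeIoiPow 2)) := by
        rw [polar_mp_symm.lintegral_comp (f := fun x => q x) (by fun_prop)]
    _ = ∫⁻ σ, (∫⁻ s, q ((homeomorphUnitSphereProd E3).symm (σ, s)) ∂(Measure.volumeIoiPow 2)) 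
          ∂((volume : Measure E3).toSphere) := by
        rw [lintegral_prod]
        apply Measurable.aemeasurable
        have : Measurable (homeomorphUnitSphereProd E3).symm := 
          (homeomorphUnitSphereProd E3).symm.continuous.measurable
        fun_prop
    _ = _ := by
        congr with σ
        simp only [homeomorphUnitSphereProd_symm_apply_coe]
        rw [Measure.volumeIoiPow, lintegral_withDensity_eq_lintegral_mul _ (by fun_prop) (by fun_prop)]
        exact lintegral_subtype_comap measurableSet_Ioi (fun s : ℝ => ENNReal.ofReal (s ^ 2) * q (s • (σ : E3)))

lemma polar_integrable_prod (q : E3 → ℂ) (hq : Integrable q) :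
    Integrable (fun z : sphere (0 : E3) 1 × Set.Ioi (0:ℝ) => q ((z.2 : ℝ) • (z.1 : E3)))
      ((volume : Measure E3).toSphere.prod (Measure.volumeIoiPow 2)) := by
  have h1 : Integrable (fun x : ({(0 : E3)}ᶜ : Set E3) => q x) ((volume : Measure E3).comap (↑)) := by
    have := hq.integrableOn (s := ({(0 : E3)}ᶜ : Set E3))
    rwa [integrableOn_iff_comap_subtypeVal (measurableSet_singleton _).compl] at this
  have h2 := (polar_mp_symm.integrable_comp_emb 
    (homeomorphUnitSphereProd E3).symm.measurableEmbedding (g := fun x => q x)).2 h1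
  exact h2

lemma volumeIoiPow_integrable_iff (g : ℝ → ℂ) :
    Integrable (fun s : Set.Ioi (0:ℝ) => g s) (Measure.volumeIoiPow 2) ↔
      IntegrableOn (fun s : ℝ => (s ^ 2 : ℝ) • g s) (Set.Ioi 0) := by
  rw [integrableOn_iff_comap_subtypeVal measurableSet_Ioi, Measure.volumeIoiPow,
    integrable_withDensity_iff_integrable_smul']
  · apply integrable_congr
    filter_upwards with s
    simp [ENNReal.toReal_ofReal (sq_nonneg _)]
  · fun_prop
  · simp

lemma volumeIoiPow_integral (g : ℝ → ℂ) :
    ∫ s : Set.Ioi (0:ℝ), g s ∂(Measure.volumeIoiPow 2) =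
      ∫ s in Set.Ioi (0:ℝ), (s ^ 2 : ℝ) • g s := by
  simp only [Measure.volumeIoiPow, ENNReal.ofReal]
  rw [integral_withDensity_eq_integral_smul, 
    integral_subtype_comap measurableSet_Ioi fun a ↦ Real.toNNReal (a ^ 2) • g a]
  · refine setIntegral_congr_fun measurableSet_Ioi fun x hx ↦ ?_
    simp only [NNReal.smul_def, Real.coe_toNNReal _ (sq_nonneg x)]
  · fun_prop

/-- If almost every ray integral (with Jacobian `s²`) equals `c`, the integral is `4πc`. -/
lemma ray_integral (q : E3 → ℂ) (hq : Integrable q) (c : ℂ)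
    (h : ∀ᵐ σ : sphere (0 : E3) 1 ∂((volume : Measure E3).toSphere), 
      IntegrableOn (fun s : ℝ => (s ^ 2 : ℝ) • q (s • (σ : E3))) (Set.Ioi 0) → 
      ∫ s in Set.Ioi (0:ℝ), (s ^ 2 : ℝ) • q (s • (σ : E3)) = c) :
    ∫ x, q x = (4 * Real.pi : ℝ) * c := by
  have hp := polar_integrable_prod q hq
  calc ∫ x, q x = ∫ x : ({(0 : E3)}ᶜ : Set E3), q x ∂((volume : Measure E3).comap (↑)) := by
        rw [integral_subtype_comap (measurableSet_singleton _).compl (fun x => q x), restrict_compl_singleton]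
    _ = ∫ z : sphere (0 : E3) 1 × Set.Ioi (0:ℝ), q ((z.2 : ℝ) • (z.1 : E3))
          ∂((volume : Measure E3).toSphere.prod (Measure.volumeIoiPow 2)) := by
        rw [← polar_mp_symm.integral_comp (homeomorphUnitSphereProd E3).symm.measurableEmbedding]
        rfl
    _ = ∫ σ : sphere (0 : E3) 1, (∫ s : Set.Ioi (0:ℝ), q ((s : ℝ) • (σ : E3)) ∂(Measure.volumeIoiPow 2))
          ∂((volume : Measure E3).toSphere) := by
        rw [integral_prod _ hp]
    _ = ∫ σ : sphere (0 : E3) 1, c ∂((volume : Measure E3).toSphere) := by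
        apply integral_congr_ae
        filter_upwards [h, hp.prod_right_ae] with σ h1 h2
        rw [volumeIoiPow_integral (fun s => q (s • (σ : E3)))]
        exact h1 ((volumeIoiPow_integrable_iff (fun s => q (s • (σ : E3)))).1 h2)
    _ = _ := by
        rw [integral_const, Measure.toSphere_real_apply_univ, finrank_E3, measureReal_def,
          EuclideanSpace.volume_ball_fin_three]
        simp only [Complex.real_smul]
        congr 1
        have hpi := Real.pi_pos
        rw [ENNReal.toReal_mul, ENNReal.toReal_pow, ENNReal.toReal_ofReal zero_le_one, ENNReal.toReal_ofReal (by positivity)]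
        push_cast
        ring

lemma toSphere_singleton (σ₀ : sphere (0 : E3) 1) : 
    (volume : Measure E3).toSphere {σ₀} = 0 := by
  rw [Measure.toSphere_apply' _ (measurableSet_singleton _)]
  have h : volume (Set.Ioo (0:ℝ) 1 • ((Subtype.val : sphere (0:E3) 1 → E3) '' {σ₀})) = 0 := by
    refine measure_mono_null (t := (Submodule.span ℝ {(σ₀ : E3)} : Set E3)) ?_ ?_
    · rintro _ ⟨t, ht, x, hx, rfl⟩
      simp only [Set.image_singleton, Set.mem_singleton_iff] at hx
      subst hx
      exact Submodule.smul_mem _ _ (Submodule.mem_span_singleton_self _)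
    · apply Measure.addHaar_submodule
      intro htop
      have h1 := finrank_span_le_card (R := ℝ) ({(σ₀ : E3)} : Set E3)
      rw [htop, finrank_top, finrank_E3] at h1
      simp at h1
  rw [h, mul_zero]

lemma final_polar (q : E3 → ENNReal) (hq : Measurable q) (r : ℝ) (hr : 0 < r) :
    ∫⁻ ρ in Set.Ioc r (r+1), ∫⁻ σ in sphere (0 : E3) 1, q (ρ • σ) ∂μH[2] ≤
      (6 * (16 * 192)) * ∫⁻ x in {x : E3 | r ≤ ‖x‖ ∧ ‖x‖ ≤ r + 1}, (ENNReal.ofReal (‖x‖ ^ 2))⁻¹ * q x := by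
  set T : Set E3 := {x : E3 | r ≤ ‖x‖ ∧ ‖x‖ ≤ r + 1} with hT
  have hTm : MeasurableSet T := 
    (measurableSet_le measurable_const measurable_norm).inter (measurableSet_le measurable_norm measurable_const)
  calc ∫⁻ ρ in Set.Ioc r (r+1), ∫⁻ σ in sphere (0 : E3) 1, q (ρ • σ) ∂μH[2] 
      ≤ ∫⁻ ρ in Set.Ioc r (r+1), (6 * (16 * 192)) * 
          ∫⁻ σ : sphere (0 : E3) 1, q (ρ • (σ : E3)) ∂((volume : Measure E3).toSphere) := by
        gcongr with ρ
        refine (lintegral_mono' hausdorff_le le_rfl).trans ?_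
        rw [lintegral_smul_measure, lintegral_map (by fun_prop) measurable_subtype_coe, smul_eq_mul]
    _ = (6 * (16 * 192)) * ∫⁻ ρ in Set.Ioc r (r+1), 
          ∫⁻ σ : sphere (0 : E3) 1, q (ρ • (σ : E3)) ∂((volume : Measure E3).toSphere) := by
        rw [lintegral_const_mul]
        exact Measurable.lintegral_prod_right' (f := fun z : ℝ × sphere (0 : E3) 1 => q (z.1 • (z.2 : E3))) (by fun_prop)
    _ = (6 * (16 * 192)) * ∫⁻ σ : sphere (0 : E3) 1, (∫⁻ ρ in Set.Ioc r (r+1), q (ρ • (σ : E3)))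
          ∂((volume : Measure E3).toSphere) := by
        rw [lintegral_lintegral_swap]
        apply Measurable.aemeasurable
        fun_prop
    _ ≤ (6 * (16 * 192)) * ∫⁻ σ : sphere (0 : E3) 1, (∫⁻ s in Set.Ioi (0:ℝ), ENNReal.ofReal (s ^ 2) * 
          T.indicator (fun x => (ENNReal.ofReal (‖x‖ ^ 2))⁻¹ * q x) (s • (σ : E3)))
          ∂((volume : Measure E3).toSphere) := by
        refine mul_le_mul' le_rfl (lintegral_mono fun σ => ?_)
        rw [← lintegral_indicator measurableSet_Ioc, ← lintegral_indicator measurableSet_Ioi]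
        refine lintegral_mono fun s => ?_
        by_cases hs : s ∈ Set.Ioc r (r+1)
        · have hs0 : 0 < s := hr.trans hs.1
          have hn : ‖s • (σ : E3)‖ = s := by
            rw [norm_smul, Real.norm_eq_abs, abs_of_pos hs0]; simp
          have hmem : s • (σ : E3) ∈ T := by
            simp only [hT, Set.mem_ofPred_eq, hn]; exact ⟨hs.1.le, hs.2⟩
          rw [Set.indicator_of_mem hs, Set.indicator_of_mem (Set.mem_Ioi.2 hs0), 
            Set.indicator_of_mem hmem, hn, ← mul_assoc, ENNReal.mul_inv_cancel, one_mul]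
          · simp; exact hs0.ne'
          · simp
        · rw [Set.indicator_of_notMem hs]; exact zero_le
    _ = _ := by
        rw [← polar_lintegral _ (Measurable.indicator (by fun_prop) hTm), lintegral_indicator hTm]

end

section

open MeasureTheory Metric Filter Topology

/-! ### The Green function of the Helmholtz equation -/

noncomputable def gf (k : ℂ) (s : ℝ) : ℂ := Complex.exp (Complex.I * k * s) / (4 * Real.pi * s)

noncomputable def dg (k : ℂ) (s : ℝ) : ℂ :=
  Complex.exp (Complex.I * k * s) * (Complex.I * k * s - 1) / (4 * Real.pi * s ^ 2)

/-- Integrable majorant. -/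
noncomputable def maj (c : ℝ) (z : E3) : ℝ := Real.exp (-c * ‖z‖) * (1 + (‖z‖⁻¹) ^ 2)

lemma maj_nonneg (c : ℝ) (z : E3) : 0 ≤ maj c z := by unfold maj; positivity

lemma maj_measurable (c : ℝ) : Measurable (maj c) := by unfold maj; fun_prop

lemma maj_integrable {c : ℝ} (hc : 0 < c) : Integrable (maj c) := by
  have h := integrable_fun_norm_addHaar (volume : Measure E3) 
    (f := fun s : ℝ => Real.exp (-c * s) * (1 + (s⁻¹) ^ 2))
  refine h.2 ?_
  rw [finrank_E3]
  have h1 : IntegrableOn (fun s : ℝ => s ^ (2:ℝ) * Real.exp (-c * s)) (Set.Ioi 0) := by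
    simpa using integrableOn_rpow_mul_exp_neg_mul_rpow (s := 2) (p := 1) (b := c) (by norm_num) one_pos hc
  have h2 : IntegrableOn (fun s : ℝ => Real.exp (-c * s)) (Set.Ioi 0) := 
    integrableOn_exp_mul_Ioi (by linarith) 0
  refine (h1.add h2).congr_fun ?_ measurableSet_Ioi
  intro s hs
  have hs0 : (s:ℝ) ≠ 0 := (Set.mem_Ioi.1 hs).ne'
  simp only [Pi.add_apply, smul_eq_mul]
  rw [Real.rpow_two]
  field_simp

lemma norm_exp_I (k : ℂ) (s : ℝ) : ‖Complex.exp (Complex.I * k * s)‖ = Real.exp (-k.im * s) := by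
  rw [Complex.norm_exp]
  simp [Complex.mul_re, Complex.mul_im]

lemma pi_inv_le : (4 * Real.pi)⁻¹ ≤ 1 := by
  apply inv_le_one_of_one_le₀
  linarith [Real.pi_gt_three]

lemma gf_norm_le (k : ℂ) {s : ℝ} (hs : 0 ≤ s) : ‖gf k s‖ ≤ Real.exp (-k.im * s) * s⁻¹ := by
  rw [gf, norm_div, norm_exp_I]
  rw [div_eq_mul_inv]
  refine mul_le_mul_of_nonneg_left ?_ (Real.exp_pos _).le
  rw [norm_mul, norm_mul, Complex.norm_real, Complex.norm_real, Real.norm_eq_abs, Real.norm_eq_abs, 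
    abs_of_nonneg hs, abs_of_pos Real.pi_pos, mul_inv]
  have := pi_inv_le
  have h2 : 0 ≤ s⁻¹ := by positivity
  simp only [Complex.norm_ofNat]
  nlinarith

lemma dg_norm_le (k : ℂ) {s : ℝ} (hs : 0 ≤ s) : 
    ‖dg k s‖ ≤ Real.exp (-k.im * s) * (‖k‖ * s⁻¹ + (s⁻¹) ^ 2) := by
  rcases hs.eq_or_lt with rfl | hs
  · simp [dg]
  rw [dg, norm_div, norm_mul, norm_exp_I, mul_div_assoc]
  gcongr
  rw [norm_mul, norm_mul, norm_pow, Complex.norm_real, Complex.norm_real, Real.norm_eq_abs, Real.norm_eq_abs, 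
    abs_of_pos hs, abs_of_pos Real.pi_pos]
  simp only [Complex.norm_ofNat]
  have h1 : ‖Complex.I * k * s - 1‖ ≤ ‖k‖ * s + 1 := by
    refine (norm_sub_le _ _).trans ?_
    simp [abs_of_pos hs]
  calc ‖Complex.I * k * s - 1‖ / (4 * Real.pi * s ^ 2) ≤ (‖k‖ * s + 1) / (1 * s ^ 2) := by
        gcongr
        linarith [Real.pi_gt_three]
    _ = _ := by field_simp

lemma inv_le_maj (x : ℝ) (_ : 0 ≤ x) : x ≤ 1 + x ^ 2 := by nlinarith [sq_nonneg (x - 1)]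

lemma gf_maj (k : ℂ) (z : E3) : ‖gf k ‖z‖‖ ≤ maj k.im z := by
  refine (gf_norm_le k (norm_nonneg z)).trans ?_
  unfold maj
  gcongr
  exact inv_le_maj _ (by positivity)

lemma dg_maj (k : ℂ) (z : E3) : ‖dg k ‖z‖‖ ≤ (‖k‖ + 1) * maj k.im z := by
  refine (dg_norm_le k (norm_nonneg z)).trans ?_
  unfold maj
  rw [mul_left_comm]
  gcongr
  have := inv_le_maj (‖z‖⁻¹) (by positivity)
  have h2 := norm_nonneg k
  nlinarith [mul_le_mul_of_nonneg_left this h2]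

lemma hasDerivAt_gf (k : ℂ) {s : ℝ} (hs : s ≠ 0) : HasDerivAt (gf k) (dg k s) s := by
  have h1 : HasDerivAt (fun s : ℝ => Complex.I * k * (s : ℂ)) (Complex.I * k * 1) s :=
    (Complex.ofRealCLM.hasDerivAt (x := s)).const_mul _
  have h2 : HasDerivAt (fun s : ℝ => (4 * Real.pi * (s : ℂ) : ℂ)) (4 * Real.pi * 1) s :=
    (Complex.ofRealCLM.hasDerivAt (x := s)).const_mul _
  have hsC : (s : ℂ) ≠ 0 := by exact_mod_cast hs
  have hpi : (Real.pi : ℂ) ≠ 0 := by exact_mod_cast Real.pi_ne_zero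
  have h3 := h1.cexp.div h2 (by simp [hsC, hpi])
  refine HasDerivAt.congr_deriv h3 ?_
  rw [dg]
  field_simp

/-- `s² g'(s)`, extended smoothly. -/
noncomputable def sdg (k : ℂ) (s : ℝ) : ℂ :=
  Complex.exp (Complex.I * k * s) * (Complex.I * k * s - 1) / (4 * Real.pi)

lemma hasDerivAt_sdg (k : ℂ) (s : ℝ) : HasDerivAt (sdg k) (-k ^ 2 * (s ^ 2 * gf k s)) s := by
  have h1 : HasDerivAt (fun s : ℝ => Complex.I * k * (s : ℂ)) (Complex.I * k * 1) s :=
    (Complex.ofRealCLM.hasDerivAt (x := s)).const_mul _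
  have h3 := (h1.cexp.mul (h1.sub_const 1)).div_const (4 * Real.pi : ℂ)
  refine HasDerivAt.congr_deriv h3 ?_
  rw [gf]
  have hpi : (Real.pi : ℂ) ≠ 0 := by exact_mod_cast Real.pi_ne_zero
  by_cases hs : s = 0
  · subst hs; simp
  have hsC : (s : ℂ) ≠ 0 := by exact_mod_cast hs
  field_simp
  ring_nf
  simp only [Complex.I_sq]
  ring

lemma sdg_eq (k : ℂ) {s : ℝ} (hs : s ≠ 0) : sdg k s = s ^ 2 * dg k s := by
  rw [sdg, dg]
  have hpi : (Real.pi : ℂ) ≠ 0 := by exact_mod_cast Real.pi_ne_zero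
  have hsC : (s : ℂ) ≠ 0 := by exact_mod_cast hs
  field_simp

lemma sdg_zero (k : ℂ) : sdg k 0 = -(1 / (4 * Real.pi)) := by
  simp [sdg]; ring

lemma sdg_norm_le (k : ℂ) {s : ℝ} (hs : 0 ≤ s) : ‖sdg k s‖ ≤ Real.exp (-k.im * s) * (‖k‖ * s + 1) := by
  rw [sdg, norm_div, norm_mul, norm_exp_I, mul_div_assoc]
  gcongr
  have h1 : ‖Complex.I * k * s - 1‖ ≤ ‖k‖ * s + 1 := by
    refine (norm_sub_le _ _).trans ?_
    simp [abs_of_nonneg hs]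
  have h2 : ‖(4 * Real.pi : ℂ)‖ = 4 * Real.pi := by
    simp [abs_of_pos Real.pi_pos]
  rw [h2]
  refine (div_le_self (norm_nonneg _) ?_).trans h1
  linarith [Real.pi_gt_three]

/-- The Green function identity. -/
lemma green_delta (k : ℂ) (ψ : E3 → ℂ) (z₀ : E3) (hz₀ : z₀ ≠ 0)
    (hd : ∀ z, z ≠ z₀ → DifferentiableAt ℝ ψ z) (C c : ℝ) (hc : c < k.im)
    (hb : ∀ z, ‖ψ z‖ ≤ C * Real.exp (c * ‖z‖))
    (hi : Integrable (fun z : E3 => dg k ‖z‖ * (fderiv ℝ ψ z (‖z‖⁻¹ • z)) - k ^ 2 * (gf k ‖z‖ * ψ z))) :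
    ∫ z : E3, (dg k ‖z‖ * (fderiv ℝ ψ z (‖z‖⁻¹ • z)) - k ^ 2 * (gf k ‖z‖ * ψ z)) = ψ 0 := by
  have hC : 0 ≤ C := by
    have := (norm_nonneg _).trans (hb 0)
    simpa using this
  rw [ray_integral _ hi (ψ 0 / (4 * Real.pi))]
  · push_cast
    have hpi : (Real.pi : ℂ) ≠ 0 := by exact_mod_cast Real.pi_ne_zero
    field_simp
  have hσ₁ : ‖z₀‖⁻¹ • z₀ ∈ sphere (0 : E3) 1 := by simp [norm_smul, hz₀]
  have hae : ∀ᵐ σ : sphere (0 : E3) 1 ∂((volume : Measure E3).toSphere), σ ≠ ⟨_, hσ₁⟩ := by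
    rw [ae_iff]; simpa using toSphere_singleton ⟨_, hσ₁⟩
  filter_upwards [hae] with σ hσ hintg
  have hσn : ‖(σ : E3)‖ = 1 := by simp
  have hne : ∀ s : ℝ, 0 ≤ s → s • (σ : E3) ≠ z₀ := by
    intro s hs h
    apply hσ
    ext1
    simp only
    have hn : s = ‖z₀‖ := by rw [← h, norm_smul, hσn, Real.norm_eq_abs, abs_of_nonneg hs, mul_one]
    rw [← hn, ← h, smul_smul, inv_mul_cancel₀ (by rw [hn]; simpa using hz₀), one_smul]
  have hder : ∀ s ∈ Set.Ioi (0:ℝ), HasDerivAt (fun s : ℝ => sdg k s * ψ (s • (σ : E3))) 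
      ((s ^ 2 : ℝ) • (dg k ‖s • (σ : E3)‖ * (fderiv ℝ ψ (s • (σ : E3)) (‖s • (σ : E3)‖⁻¹ • (s • (σ : E3)))) - 
        k ^ 2 * (gf k ‖s • (σ : E3)‖ * ψ (s • (σ : E3))))) s := by
    intro s hs
    have hs0 : 0 < s := hs
    have hn : ‖s • (σ : E3)‖ = s := by rw [norm_smul, hσn, Real.norm_eq_abs, abs_of_pos hs0, mul_one]
    have h1 : HasDerivAt (fun s : ℝ => s • (σ : E3)) ((1:ℝ) • (σ : E3)) s := 
      (hasDerivAt_id s).smul_const _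
    have h2 := (hd _ (hne s hs0.le)).hasFDerivAt.comp_hasDerivAt s h1
    have h3 := (hasDerivAt_sdg k s).mul h2
    refine HasDerivAt.congr_deriv h3 ?_
    rw [hn, smul_smul, inv_mul_cancel₀ hs0.ne', sdg_eq k hs0.ne']
    simp only [Complex.real_smul, Function.comp]
    push_cast
    ring
  have hcont : ContinuousWithinAt (fun s : ℝ => sdg k s * ψ (s • (σ : E3))) (Set.Ici 0) 0 := by
    apply ContinuousAt.continuousWithinAt
    have h0 : ContinuousAt ψ ((0:ℝ) • (σ : E3)) := (hd _ (hne 0 le_rfl)).continuousAt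
    exact (hasDerivAt_sdg k 0).continuousAt.mul 
      (ContinuousAt.comp (f := fun s : ℝ => s • (σ : E3)) h0 (by fun_prop))
  have hlim : Tendsto (fun s : ℝ => sdg k s * ψ (s • (σ : E3))) atTop (𝓝 0) := by
    have hT : Tendsto (fun s : ℝ => C * (‖k‖ * (s ^ (1:ℝ) * Real.exp (-(k.im - c) * s)) + 
        s ^ (0:ℝ) * Real.exp (-(k.im - c) * s))) atTop (𝓝 0) := by
      have t1 := tendsto_rpow_mul_exp_neg_mul_atTop_nhds_zero 1 (k.im - c) (by linarith)
      have t0 := tendsto_rpow_mul_exp_neg_mul_atTop_nhds_zero 0 (k.im - c) (by linarith)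
      simpa using ((t1.const_mul ‖k‖).add t0).const_mul C
    refine squeeze_zero_norm' ?_ hT
    filter_upwards [eventually_ge_atTop 0] with s hs
    have hn : ‖s • (σ : E3)‖ = s := by rw [norm_smul, hσn, Real.norm_eq_abs, abs_of_nonneg hs, mul_one]
    rw [norm_mul]
    calc ‖sdg k s‖ * ‖ψ (s • (σ : E3))‖ ≤ (Real.exp (-k.im * s) * (‖k‖ * s + 1)) * (C * Real.exp (c * s)) := by
          gcongr
          · exact sdg_norm_le k hs
          · have := hb (s • (σ : E3)); rwa [hn] at this
      _ = _ := by
          rw [show -(k.im - c) * s = -k.im * s + c * s by ring, Real.exp_add, Real.rpow_one, Real.rpow_zero]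
          ring
  rw [integral_Ioi_of_hasDerivAt_of_tendsto hcont hder hintg hlim]
  simp [sdg_zero]
  ring

end

section

open MeasureTheory Metric Filter Topology

/-! ### Regularity of the convolution with the Green function -/

lemma bound_exp {φ : E3 → ℂ} (hφ : Continuous φ) (hs : HasCompactSupport φ) (c : ℝ) :
    ∃ C, 0 ≤ C ∧ ∀ x, ‖φ x‖ ≤ C * Real.exp (-c * ‖x‖) := by
  have h1 : Continuous (fun x => φ x * (Real.exp (c * ‖x‖) : ℂ)) := by fun_prop
  obtain ⟨C, hC⟩ := h1.bounded_above_of_compact_support (hs.mul_right)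
  refine ⟨C, (norm_nonneg _).trans (hC 0), fun x => ?_⟩
  have := hC x
  rw [norm_mul, Complex.norm_real, Real.norm_eq_abs, abs_of_pos (Real.exp_pos _)] at this
  calc ‖φ x‖ = (‖φ x‖ * Real.exp (c * ‖x‖)) * Real.exp (-c * ‖x‖) := by
        rw [mul_assoc, ← Real.exp_add]; simp
    _ ≤ _ := by gcongr

lemma gf_measurable (k : ℂ) : Measurable (gf k) := by unfold gf; fun_prop
lemma dg_measurable (k : ℂ) : Measurable (dg k) := by unfold dg; fun_prop

lemma gf_locInt {k : ℂ} (hk : 0 < k.im) : Integrable (fun z : E3 => gf k ‖z‖) := by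
  refine (maj_integrable hk).mono' ?_ ?_
  · exact ((gf_measurable k).comp measurable_norm).aestronglyMeasurable
  · filter_upwards with z using gf_maj k z

lemma dg_continuousAt (k : ℂ) {s : ℝ} (hs : s ≠ 0) : ContinuousAt (dg k) s := by
  unfold dg
  have hpi : (Real.pi : ℂ) ≠ 0 := by exact_mod_cast Real.pi_ne_zero
  have hsC : (s : ℂ) ≠ 0 := by exact_mod_cast hs
  apply ContinuousAt.div
  · fun_prop
  · fun_prop
  · simp [hpi, hsC]

/-- regularized norm -/
noncomputable def rn (δ : ℝ) (z : E3) : ℝ := √(‖z‖ ^ 2 + δ ^ 2)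

lemma rn_pos {δ : ℝ} (hδ : 0 < δ) (z : E3) : 0 < rn δ z := by unfold rn; positivity

lemma rn_ge (δ : ℝ) (z : E3) : ‖z‖ ≤ rn δ z := by
  unfold rn
  apply Real.le_sqrt_of_sq_le
  nlinarith [sq_nonneg δ]

lemma rn_hasFDerivAt {δ : ℝ} (hδ : 0 < δ) (z : E3) : 
    HasFDerivAt (rn δ) ((rn δ z)⁻¹ • innerSL ℝ z) z := by
  have h1 : HasFDerivAt (fun z : E3 => ‖z‖ ^ 2 + δ ^ 2) (2 • innerSL ℝ z) z :=
    (hasStrictFDerivAt_norm_sq z).hasFDerivAt.add_const _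
  have h2 := h1.sqrt (by positivity)
  refine h2.congr_fderiv ?_
  ext v
  have := (rn_pos hδ z).ne'
  simp only [rn] at this
  simp [rn]
  field_simp

lemma rn_continuous (δ : ℝ) : Continuous (rn δ) := by unfold rn; fun_prop

lemma rn_tendsto (z : E3) : Tendsto (fun n : ℕ => rn (1 / ((n:ℝ) + 1)) z) atTop (𝓝 ‖z‖) := by
  have h : Tendsto (fun n : ℕ => √(‖z‖ ^ 2 + (1 / ((n:ℝ) + 1)) ^ 2)) atTop (𝓝 √(‖z‖ ^ 2 + 0 ^ 2)) := by
    apply Tendsto.sqrt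
    exact ((tendsto_one_div_add_atTop_nhds_zero_nat (𝕜 := ℝ)).pow 2).const_add _
  simpa [rn] using h

lemma maj_mono_norm (k : ℂ) (hk : 0 < k.im) {s : ℝ} {z : E3} (hz : z ≠ 0) (hs : ‖z‖ ≤ s) : 
    ‖gf k s‖ ≤ 1 + (‖z‖⁻¹)^2 ∧ ‖dg k s‖ ≤ (‖k‖ + 1) * (1 + (‖z‖⁻¹)^2) := by
  have hz0 : 0 < ‖z‖ := norm_pos_iff.2 hz
  have hs0 : 0 < s := hz0.trans_le hs
  have he : Real.exp (-k.im * s) ≤ 1 := by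
    rw [Real.exp_le_one_iff]; nlinarith
  have hi : s⁻¹ ≤ ‖z‖⁻¹ := by gcongr
  have hi0 : 0 < s⁻¹ := by positivity
  have h1 := inv_le_maj s⁻¹ hi0.le
  have h2 : (s⁻¹)^2 ≤ (‖z‖⁻¹)^2 := by gcongr
  have hk0 := norm_nonneg k
  constructor
  · refine (gf_norm_le k hs0.le).trans ?_
    nlinarith [Real.exp_pos (-k.im * s)]
  · refine (dg_norm_le k hs0.le).trans ?_
    have : ‖k‖ * s⁻¹ + s⁻¹ ^ 2 ≤ (‖k‖ + 1) * (1 + (‖z‖⁻¹)^2) := by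
      nlinarith [mul_le_mul_of_nonneg_left h1 hk0, mul_le_mul_of_nonneg_left h2 hk0]
    have h0 : 0 ≤ ‖k‖ * s⁻¹ + s⁻¹ ^ 2 := by positivity
    calc _ ≤ 1 * (‖k‖ * s⁻¹ + s⁻¹ ^ 2) := by gcongr
      _ ≤ _ := by linarith

lemma gf_ibp {k : ℂ} (hk : 0 < k.im) {φ : E3 → ℂ} (hφ : ContDiff ℝ 1 φ) (hs : HasCompactSupport φ) (v : E3) :
    ∫ z : E3, gf k ‖z‖ * fderiv ℝ φ z v = 
      -∫ z : E3, dg k ‖z‖ * (((‖z‖⁻¹ * inner ℝ z v : ℝ) : ℂ)) * φ z := by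
  have hφ' : Continuous (fun z => fderiv ℝ φ z v) := (hφ.continuous_fderiv one_ne_zero).clm_apply continuous_const
  have hs' : HasCompactSupport (fun z => fderiv ℝ φ z v) := hs.fderiv_apply ℝ v
  obtain ⟨C, hC0, hC⟩ := bound_exp hφ.continuous hs 1
  obtain ⟨C', hC0', hC'⟩ := bound_exp hφ' hs' 1
  set δ : ℕ → ℝ := fun n => 1 / ((n:ℝ) + 1) with hδ
  have hδ0 : ∀ n, 0 < δ n := fun n => by simp only [hδ]; positivity
  have hgc : ∀ n, Continuous (fun z => gf k (rn (δ n) z)) := fun n => 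
    continuous_iff_continuousAt.2 fun z => ContinuousAt.comp (hasDerivAt_gf k (rn_pos (hδ0 n) z).ne').continuousAt (rn_continuous _).continuousAt
  have hdc : ∀ n, Continuous (fun z => dg k (rn (δ n) z)) := fun n => 
    continuous_iff_continuousAt.2 fun z => ContinuousAt.comp (dg_continuousAt k (rn_pos (hδ0 n) z).ne') (rn_continuous _).continuousAt
  have hic : ∀ n, Continuous (fun z => (rn (δ n) z)⁻¹ * inner ℝ z v) := fun n => 
    ((rn_continuous _).inv₀ (fun z => (rn_pos (hδ0 n) z).ne')).mul (by fun_prop)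
  have hn : ∀ n, ∫ z : E3, gf k (rn (δ n) z) * fderiv ℝ φ z v = 
      -∫ z : E3, dg k (rn (δ n) z) * ((((rn (δ n) z)⁻¹ * inner ℝ z v : ℝ) : ℂ)) * φ z := by
    intro n
    have hder : ∀ z : E3, HasFDerivAt (fun z => gf k (rn (δ n) z)) 
        (((rn (δ n) z)⁻¹ • innerSL ℝ z).smulRight (dg k (rn (δ n) z))) z := by
      intro z
      exact (hasDerivAt_gf k (rn_pos (hδ0 n) z).ne').hasFDerivAt.comp z (rn_hasFDerivAt (hδ0 n) z) |>.congr_fderiv (by ext w; simp; ring)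
    have e : ∀ z, (fderiv ℝ (fun z => gf k (rn (δ n) z)) z) v * φ z = 
        dg k (rn (δ n) z) * ((((rn (δ n) z)⁻¹ * inner ℝ z v : ℝ) : ℂ)) * φ z := by
      intro z
      rw [(hder z).fderiv]
      simp
      left
      ring
    have hc1 : Continuous (fun z => dg k (rn (δ n) z) * ((((rn (δ n) z)⁻¹ * inner ℝ z v : ℝ) : ℂ)) * φ z) :=
      ((hdc n).mul (Complex.continuous_ofReal.comp (hic n))).mul hφ.continuous
    rw [integral_mul_fderiv_eq_neg_fderiv_mul_of_integrable]
    · simp_rw [e]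
    · simp_rw [e]
      exact hc1.integrable_of_hasCompactSupport hs.mul_left
    · exact ((hgc n).mul hφ').integrable_of_hasCompactSupport hs'.mul_left
    · exact ((hgc n).mul hφ.continuous).integrable_of_hasCompactSupport hs.mul_left
    · exact fun z _ => (hder z).differentiableAt
    · exact fun z _ => (hφ.differentiable one_ne_zero).differentiableAt
  have hne : ∀ᵐ z : E3, z ≠ 0 := by 
    rw [ae_iff]; simp
  have hL : Tendsto (fun n => ∫ z : E3, gf k (rn (δ n) z) * fderiv ℝ φ z v) atTop 
      (𝓝 (∫ z : E3, gf k ‖z‖ * fderiv ℝ φ z v)) := by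
    refine tendsto_integral_of_dominated_convergence (fun z => C' * maj 1 z) ?_ ?_ ?_ ?_
    · exact fun n => ((hgc n).mul hφ').aestronglyMeasurable
    · exact (maj_integrable one_pos).const_mul _
    · intro n
      filter_upwards [hne] with z hz
      rw [norm_mul]
      calc _ ≤ (1 + (‖z‖⁻¹)^2) * (C' * Real.exp (-1 * ‖z‖)) := by
            gcongr
            · exact (maj_mono_norm k hk hz (rn_ge _ _)).1
            · exact hC' z
        _ = _ := by unfold maj; ring
    · filter_upwards [hne] with z hz
      refine Tendsto.mul_const _ ?_
      exact (hasDerivAt_gf k (norm_ne_zero_iff.2 hz)).continuousAt.tendsto.comp (rn_tendsto z)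
  have hR : Tendsto (fun n => ∫ z : E3, dg k (rn (δ n) z) * ((((rn (δ n) z)⁻¹ * inner ℝ z v : ℝ) : ℂ)) * φ z) atTop 
      (𝓝 (∫ z : E3, dg k ‖z‖ * (((‖z‖⁻¹ * inner ℝ z v : ℝ) : ℂ)) * φ z)) := by
    refine tendsto_integral_of_dominated_convergence (fun z => ((‖k‖ + 1) * ‖v‖ * C) * maj 1 z) ?_ ?_ ?_ ?_
    · exact fun n => (((hdc n).mul (Complex.continuous_ofReal.comp (hic n))).mul hφ.continuous).aestronglyMeasurable
    · exact (maj_integrable one_pos).const_mul _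
    · intro n
      filter_upwards [hne] with z hz
      rw [norm_mul, norm_mul, Complex.norm_real]
      have h1 : ‖(rn (δ n) z)⁻¹ * inner ℝ z v‖ ≤ ‖v‖ := by
        rw [norm_mul, norm_inv, Real.norm_eq_abs (rn _ _), abs_of_pos (rn_pos (hδ0 n) z), inv_mul_le_iff₀ (rn_pos (hδ0 n) z)]
        refine (norm_inner_le_norm z v).trans ?_
        gcongr
        exact rn_ge _ _
      calc _ ≤ ((‖k‖ + 1) * (1 + (‖z‖⁻¹)^2)) * ‖v‖ * (C * Real.exp (-1 * ‖z‖)) := by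
            gcongr
            · exact (maj_mono_norm k hk hz (rn_ge _ _)).2
            · exact hC z
        _ = _ := by unfold maj; ring
    · filter_upwards [hne] with z hz
      refine Tendsto.mul_const _ (Tendsto.mul ?_ ?_)
      · exact (dg_continuousAt k (norm_ne_zero_iff.2 hz)).tendsto.comp (rn_tendsto z)
      · refine (Complex.continuous_ofReal.tendsto _).comp ?_
        exact ((rn_tendsto z).inv₀ (norm_ne_zero_iff.2 hz)).mul_const _
  have hR' := hR.neg
  simp_rw [← hn] at hR'
  exact tendsto_nhds_unique hL hR'

/-- The resolvent applied to `F`. -/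
noncomputable def res (k : ℂ) (F : E3 → ℂ) (x : E3) : ℂ := ∫ t : E3, gf k ‖t‖ * F (x - t)

lemma res_eq_conv (k : ℂ) (F : E3 → ℂ) : 
    res k F = convolution (fun z : E3 => gf k ‖z‖) F (ContinuousLinearMap.mul ℝ ℂ) volume := by
  ext x; rfl

lemma res_contDiff {k : ℂ} (hk : 0 < k.im) {F : E3 → ℂ} (hF : ContDiff ℝ 1 F) (hs : HasCompactSupport F) :
    ContDiff ℝ 1 (res k F) := by
  rw [res_eq_conv]
  exact HasCompactSupport.contDiff_convolution_right (n := 1) _ hs (gf_locInt hk).locallyIntegrable hF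

lemma res_fderiv {k : ℂ} (hk : 0 < k.im) {F : E3 → ℂ} (hF : ContDiff ℝ 1 F) (hs : HasCompactSupport F) (x v : E3) :
    fderiv ℝ (res k F) x v = ∫ t : E3, gf k ‖t‖ * (fderiv ℝ F (x - t) v) := by
  have h := HasCompactSupport.hasFDerivAt_convolution_right (ContinuousLinearMap.mul ℝ ℂ) hs 
    (gf_locInt hk).locallyIntegrable hF x
  rw [res_eq_conv, h.fderiv]
  rw [convolution_precompR_apply _ (gf_locInt hk).locallyIntegrable (hs.fderiv ℝ) (hF.continuous_fderiv one_ne_zero)]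
  rfl

lemma res_fderiv' {k : ℂ} (hk : 0 < k.im) {F : E3 → ℂ} (hF : ContDiff ℝ 1 F) (hs : HasCompactSupport F) (x v : E3) :
    fderiv ℝ (res k F) x v = ∫ t : E3, dg k ‖t‖ * (((‖t‖⁻¹ * inner ℝ t v : ℝ) : ℂ)) * F (x - t) := by
  rw [res_fderiv hk hF hs]
  have h1 : ContDiff ℝ 1 (fun t => F (x - t)) := hF.comp (by fun_prop)
  have h2 : HasCompactSupport (fun t => F (x - t)) := hs.comp_homeomorph (Homeomorph.subLeft x)
  have h := gf_ibp hk h1 h2 v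
  have e : ∀ t, fderiv ℝ (fun t => F (x - t)) t v = - fderiv ℝ F (x - t) v := by
    intro t
    have hd : HasFDerivAt (fun t => F (x - t)) ((fderiv ℝ F (x - t)).comp (-(ContinuousLinearMap.id ℝ E3))) t :=
      (hF.differentiable one_ne_zero (x - t)).hasFDerivAt.comp t ((hasFDerivAt_id t).const_sub x)
    rw [hd.fderiv]; simp
  simp_rw [e, mul_neg, integral_neg, neg_inj] at h
  exact h

lemma res_bound_aux {k : ℂ} {η : ℝ} (hη : 0 < η) (hηk : η ≤ k.im) {φ : E3 → ℂ} 
    (C : ℝ) (hC0 : 0 ≤ C) (hC : ∀ x, ‖φ x‖ ≤ C * Real.exp (-k.im * ‖x‖)) (x : E3) :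
    ‖∫ t : E3, gf k ‖t‖ * φ (x - t)‖ ≤ (C * ∫ t : E3, maj η t) * Real.exp (-(k.im - η) * ‖x‖) := by
  have : ∀ t : E3, ‖gf k ‖t‖ * φ (x - t)‖ ≤ (C * Real.exp (-(k.im - η) * ‖x‖)) * maj η t := by
    intro t
    rw [norm_mul]
    calc _ ≤ maj k.im t * (C * Real.exp (-k.im * ‖x - t‖)) := by
          gcongr
          · exact maj_nonneg _ _
          · exact gf_maj k t
          · exact hC _
      _ = C * (Real.exp (-k.im * ‖t‖ - k.im * ‖x - t‖) * (1 + (‖t‖⁻¹)^2)) := by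
          rw [show -k.im * ‖t‖ - k.im * ‖x - t‖ = -k.im * ‖t‖ + -k.im * ‖x - t‖ by ring, Real.exp_add]; unfold maj; ring
      _ ≤ C * (Real.exp (-(k.im - η) * ‖x‖ + (-η * ‖t‖)) * (1 + (‖t‖⁻¹)^2)) := by
          gcongr
          have h1 : ‖x‖ ≤ ‖t‖ + ‖x - t‖ := by
            have := norm_add_le t (x - t); simpa using this
          nlinarith [norm_nonneg (x - t), norm_nonneg t]
      _ = _ := by rw [Real.exp_add]; unfold maj; ring
  refine (norm_integral_le_of_norm_le ((maj_integrable hη).const_mul _) (Eventually.of_forall this)).trans ?_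
  rw [integral_const_mul]
  apply le_of_eq; ring

lemma res_bound {k : ℂ} {η : ℝ} (hη : 0 < η) (hηk : η ≤ k.im) {F : E3 → ℂ} 
    (hF : ContDiff ℝ 1 F) (hs : HasCompactSupport F) :
    ∃ C, 0 ≤ C ∧ ∀ x, ‖res k F x‖ ≤ C * Real.exp (-(k.im - η) * ‖x‖) ∧ 
      ∀ i : Fin 3, ‖fderiv ℝ (res k F) x (EuclideanSpace.single i 1)‖ ≤ C * Real.exp (-(k.im - η) * ‖x‖) := by
  have hk : 0 < k.im := hη.trans_le hηk
  obtain ⟨C, hC0, hC⟩ := bound_exp hF.continuous hs k.im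
  have h2 : ∀ i : Fin 3, ∃ C, 0 ≤ C ∧ ∀ x, ‖fderiv ℝ F x (EuclideanSpace.single i 1)‖ ≤ C * Real.exp (-k.im * ‖x‖) := 
    fun i => bound_exp ((hF.continuous_fderiv one_ne_zero).clm_apply continuous_const) (hs.fderiv_apply ℝ _) k.im
  choose D hD0 hD using h2
  have hI : 0 ≤ ∫ t : E3, maj η t := integral_nonneg fun t => maj_nonneg _ _
  refine ⟨(C + ∑ i, D i) * ∫ t : E3, maj η t, ?_, fun x => ⟨?_, fun i => ?_⟩⟩
  · exact mul_nonneg (add_nonneg hC0 (Finset.sum_nonneg fun i _ => hD0 i)) hI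
  · refine (res_bound_aux hη hηk C hC0 hC x).trans ?_
    gcongr
    linarith [Finset.sum_nonneg (fun i (_ : i ∈ Finset.univ) => hD0 i)]
  · rw [res_fderiv hk hF hs]
    refine (res_bound_aux hη hηk (D i) (hD0 i) (hD i) x).trans ?_
    gcongr
    linarith [Finset.single_le_sum (fun i _ => hD0 i) (Finset.mem_univ i)]

end

section

open MeasureTheory Metric Filter Topology

/-! ### The weak form of the Helmholtz equation -/

lemma sum_single (L : E3 →L[ℝ] ℂ) (t : E3) : 
    ∑ i : Fin 3, ((inner ℝ t (EuclideanSpace.single i 1) : ℝ) : ℂ) * L (EuclideanSpace.single i 1) = L t := by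
  have : t = ∑ i : Fin 3, (inner ℝ t (EuclideanSpace.single i 1) : ℝ) • (EuclideanSpace.single i (1:ℝ) : E3) := by
    ext j
    simp [EuclideanSpace.inner_single_right, Finset.sum_apply, Pi.single_apply]
  conv_rhs => rw [this]
  simp [map_sum]

lemma inner_unit_le (t : E3) (i : Fin 3) : 
    ‖(((‖t‖⁻¹ * inner ℝ t (EuclideanSpace.single i 1) : ℝ)) : ℂ)‖ ≤ 1 := by
  rw [Complex.norm_real, norm_mul, norm_inv, norm_norm]
  have h := norm_inner_le_norm (𝕜 := ℝ) t (EuclideanSpace.single i (1:ℝ))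
  rw [EuclideanSpace.norm_single, norm_one, mul_one] at h
  by_cases ht : ‖t‖ = 0
  · simp [ht]
  · have : 0 < ‖t‖ := lt_of_le_of_ne (norm_nonneg _) (Ne.symm ht)
    rw [inv_mul_le_iff₀ this]; simpa using h

/-- the two-variable integrand -/
noncomputable def MM (k : ℂ) (F ψ : E3 → ℂ) (y t : E3) : ℂ :=
  ∑ i : Fin 3, (dg k ‖t‖ * (((‖t‖⁻¹ * inner ℝ t (EuclideanSpace.single i 1) : ℝ)) : ℂ) * F y) * 
      fderiv ℝ ψ (y + t) (EuclideanSpace.single i 1)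
    - k ^ 2 * ((gf k ‖t‖ * F y) * ψ (y + t))

lemma MM_eq (k : ℂ) (F ψ : E3 → ℂ) (y t : E3) : MM k F ψ y t = 
    F y * (dg k ‖t‖ * (fderiv ℝ ψ (y + t) (‖t‖⁻¹ • t)) - k ^ 2 * (gf k ‖t‖ * ψ (y + t))) := by
  unfold MM
  rw [map_smul, ← sum_single (fderiv ℝ ψ (y + t)) t]
  simp only [Finset.smul_sum, Finset.mul_sum, mul_sub]
  congr 1
  · refine Finset.sum_congr rfl fun i _ => ?_
    rw [Complex.real_smul]; push_cast; ring
  · ring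

lemma MM_measurable (k : ℂ) {F ψ : E3 → ℂ} (hF : Continuous F) (hψ : Continuous ψ) : 
    Measurable (fun p : E3 × E3 => MM k F ψ p.1 p.2) := by
  unfold MM
  refine Measurable.sub (Finset.measurable_sum _ fun i _ => ?_) ?_
  · refine Measurable.mul (Measurable.mul (Measurable.mul ?_ ?_) ?_) ?_
    · exact (dg_measurable k).comp (measurable_norm.comp measurable_snd)
    · exact Complex.measurable_ofReal.comp (by fun_prop)
    · exact hF.measurable.comp measurable_fst
    · exact (measurable_fderiv_apply_const ℝ ψ _).comp (measurable_fst.add measurable_snd)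
  · refine Measurable.const_mul (Measurable.mul (Measurable.mul ?_ ?_) ?_) _
    · exact (gf_measurable k).comp (measurable_norm.comp measurable_snd)
    · exact hF.measurable.comp measurable_fst
    · exact hψ.measurable.comp (measurable_fst.add measurable_snd)

lemma MM_bound {k : ℂ} {F ψ : E3 → ℂ} {C c : ℝ} (hc0 : 0 ≤ c)
    (hb : ∀ x, ‖ψ x‖ ≤ C * Real.exp (c * ‖x‖)) 
    (hb' : ∀ x (i : Fin 3), ‖fderiv ℝ ψ x (EuclideanSpace.single i 1)‖ ≤ C * Real.exp (c * ‖x‖)) (y t : E3) :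
    ‖MM k F ψ y t‖ ≤ ((C * (3 * (‖k‖ + 1) + ‖k‖ ^ 2)) * (‖F y‖ * Real.exp (c * ‖y‖))) * maj (k.im - c) t := by
  have hC : 0 ≤ C := by
    have := (norm_nonneg _).trans (hb 0)
    simpa using this
  have he : Real.exp (c * ‖y + t‖) ≤ Real.exp (c * ‖y‖) * Real.exp (c * ‖t‖) := by
    rw [← Real.exp_add]
    gcongr
    nlinarith [norm_add_le y t]
  have hm : maj k.im t * Real.exp (c * ‖t‖) = maj (k.im - c) t := by
    unfold maj
    rw [show -(k.im - c) * ‖t‖ = -k.im * ‖t‖ + c * ‖t‖ by ring, Real.exp_add]; ring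
  have hm0 := maj_nonneg k.im t
  have h1 : ∀ i : Fin 3, ‖(dg k ‖t‖ * (((‖t‖⁻¹ * inner ℝ t (EuclideanSpace.single i 1) : ℝ)) : ℂ) * F y) * 
      fderiv ℝ ψ (y + t) (EuclideanSpace.single i 1)‖ ≤ 
      ((‖k‖+1) * maj k.im t * 1 * ‖F y‖) * (C * (Real.exp (c * ‖y‖) * Real.exp (c * ‖t‖))) := by
    intro i
    rw [norm_mul, norm_mul, norm_mul]
    gcongr
    · exact dg_maj k t
    · exact inner_unit_le t i
    · exact (hb' _ i).trans (by gcongr)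
  have h2 : ‖k ^ 2 * ((gf k ‖t‖ * F y) * ψ (y + t))‖ ≤ 
      ‖k‖^2 * ((maj k.im t * ‖F y‖) * (C * (Real.exp (c * ‖y‖) * Real.exp (c * ‖t‖)))) := by
    rw [norm_mul, norm_mul, norm_mul, norm_pow]
    gcongr
    · exact gf_maj k t
    · exact (hb _).trans (by gcongr)
  unfold MM
  refine (norm_sub_le _ _).trans ((add_le_add (norm_sum_le_of_le _ fun i _ => h1 i) h2).trans ?_)
  rw [← hm, Finset.sum_const]
  apply le_of_eq
  simp
  ring

lemma MM_integrable {k : ℂ} {F ψ : E3 → ℂ} (hF : Continuous F) (hs : HasCompactSupport F) (hψ : Continuous ψ)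
    {C c : ℝ} (hc0 : 0 ≤ c) (hc : c < k.im)
    (hb : ∀ x, ‖ψ x‖ ≤ C * Real.exp (c * ‖x‖)) 
    (hb' : ∀ x (i : Fin 3), ‖fderiv ℝ ψ x (EuclideanSpace.single i 1)‖ ≤ C * Real.exp (c * ‖x‖)) :
    Integrable (fun p : E3 × E3 => MM k F ψ p.1 p.2) (volume.prod volume) := by
  have h1 : Integrable (fun y : E3 => (C * (3 * (‖k‖ + 1) + ‖k‖ ^ 2)) * (‖F y‖ * Real.exp (c * ‖y‖))) := by
    refine Integrable.const_mul ?_ _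
    refine Continuous.integrable_of_hasCompactSupport (by fun_prop) ?_
    exact hs.norm.mul_right
  refine (h1.mul_prod (maj_integrable (show 0 < k.im - c by linarith))).mono' ?_ ?_
  · exact (MM_measurable k hF hψ).aestronglyMeasurable
  · exact Eventually.of_forall fun p => MM_bound hc0 hb hb' p.1 p.2

lemma weak_id {k : ℂ} {F ψ : E3 → ℂ} (hF : ContDiff ℝ 1 F) (hs : HasCompactSupport F) (hF0 : F 0 = 0) 
    (hψ : Continuous ψ) (hd : ∀ z, z ≠ 0 → DifferentiableAt ℝ ψ z)
    {C c : ℝ} (hc0 : 0 ≤ c) (hc : c < k.im)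
    (hb : ∀ x, ‖ψ x‖ ≤ C * Real.exp (c * ‖x‖)) 
    (hb' : ∀ x (i : Fin 3), ‖fderiv ℝ ψ x (EuclideanSpace.single i 1)‖ ≤ C * Real.exp (c * ‖x‖)) :
    ∫ x : E3, (∑ i : Fin 3, fderiv ℝ (res k F) x (EuclideanSpace.single i 1) * 
        fderiv ℝ ψ x (EuclideanSpace.single i 1) - k ^ 2 * (res k F x * ψ x)) = ∫ x : E3, F x * ψ x := by
  have hk : 0 < k.im := hc0.trans_lt hc
  have hC : 0 ≤ C := by
    have := (norm_nonneg _).trans (hb 0)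
    simpa using this
  obtain ⟨B, hB0, hB⟩ := bound_exp hF.continuous hs 0
  simp only [neg_zero, zero_mul, Real.exp_zero, mul_one] at hB
  have hI := MM_integrable hF.continuous hs hψ hc0 hc hb hb'
  have hT : MeasurePreserving (fun z : E3 × E3 => (z.1 - z.2, z.2)) (volume.prod volume) (volume.prod volume) :=
    measurePreserving_sub_prod volume volume
  have hI2 : Integrable (fun z : E3 × E3 => MM k F ψ (z.1 - z.2) z.2) (volume.prod volume) := 
    hT.integrable_comp_of_integrable hI
  have e1 : ∀ x : E3, (∑ i : Fin 3, fderiv ℝ (res k F) x (EuclideanSpace.single i 1) * 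
        fderiv ℝ ψ x (EuclideanSpace.single i 1) - k ^ 2 * (res k F x * ψ x)) = 
        ∫ t : E3, MM k F ψ (x - t) t := by
    intro x
    have i1 : ∀ i : Fin 3, Integrable (fun t : E3 => dg k ‖t‖ * (((‖t‖⁻¹ * inner ℝ t (EuclideanSpace.single i 1) : ℝ)) : ℂ) * F (x - t)) := by
      intro i
      refine ((maj_integrable hk).const_mul ((‖k‖+1)*1*B)).mono' ?_ (Eventually.of_forall fun t => ?_)
      · refine (Measurable.mul (Measurable.mul ?_ ?_) ?_).aestronglyMeasurable
        · exact (dg_measurable k).comp measurable_norm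
        · exact Complex.measurable_ofReal.comp (by fun_prop)
        · exact hF.continuous.measurable.comp (by fun_prop)
      · rw [norm_mul, norm_mul]
        calc _ ≤ ((‖k‖+1) * maj k.im t) * 1 * B := by
              have := maj_nonneg k.im t
              gcongr
              · exact dg_maj k t
              · exact inner_unit_le t i
              · exact hB _
          _ = _ := by ring
    have i2 : Integrable (fun t : E3 => gf k ‖t‖ * F (x - t)) := by
      refine ((maj_integrable hk).const_mul B).mono' ?_ (Eventually.of_forall fun t => ?_)
      · refine (Measurable.mul ?_ ?_).aestronglyMeasurable
        · exact (gf_measurable k).comp measurable_norm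
        · exact hF.continuous.measurable.comp (by fun_prop)
      · rw [norm_mul]
        calc _ ≤ maj k.im t * B := by
              have := maj_nonneg k.im t
              gcongr
              · exact gf_maj k t
              · exact hB _
          _ = _ := by ring
    unfold MM
    simp only [sub_add_cancel]
    rw [integral_sub, integral_finsetSum, integral_const_mul, integral_mul_const]
    · congr 1
      refine Finset.sum_congr rfl fun i _ => ?_
      rw [integral_mul_const, res_fderiv' hk hF hs]
    · exact fun i _ => (i1 i).mul_const _
    · exact integrable_finsetSum _ fun i _ => (i1 i).mul_const _
    · exact (i2.mul_const _).const_mul _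
  have e2 : ∀ᵐ y : E3, ∫ t : E3, MM k F ψ y t = F y * ψ y := by
    filter_upwards [hI.prod_right_ae] with y hy
    by_cases hFy : F y = 0
    · simp [MM_eq, hFy]
    have hy0 : y ≠ 0 := fun h => hFy (by rw [h, hF0])
    simp only [MM_eq] at hy ⊢
    have hy' := (integrable_const_mul_iff (IsUnit.mk0 _ hFy) _).1 hy
    rw [integral_const_mul]
    congr 1
    have e3 : ∀ t, fderiv ℝ ψ (y + t) = fderiv ℝ (fun t => ψ (y + t)) t := fun t => (fderiv_comp_add_left y).symm
    simp only [e3] at hy' ⊢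
    have := green_delta k (fun t => ψ (y + t)) (-y) (neg_ne_zero.2 hy0) ?_ (C * Real.exp (c * ‖y‖)) c hc ?_ hy'
    · rw [this, add_zero]
    · intro z hz
      have : y + z ≠ 0 := fun h => hz (by rw [eq_neg_iff_add_eq_zero, add_comm]; exact h)
      exact (hd _ this).comp z (by fun_prop)
    · intro z
      refine (hb _).trans ?_
      rw [mul_assoc, ← Real.exp_add]
      gcongr
      nlinarith [norm_add_le y z]
  simp_rw [e1]
  rw [integral_integral (f := fun x t => MM k F ψ (x - t) t) hI2]
  have e4 : ∫ z : E3 × E3, MM k F ψ (z.1 - z.2) z.2 ∂(volume.prod volume) = ∫ z : E3 × E3, MM k F ψ z.1 z.2 ∂(volume.prod volume) := by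
    conv_rhs => rw [← hT.map_eq]
    rw [integral_map hT.aemeasurable]
    rw [hT.map_eq]; exact hI.aestronglyMeasurable
  rw [e4, integral_prod _ hI]
  exact integral_congr_ae e2

end

section

open MeasureTheory Metric Filter Topology

/-! ### Weights -/

noncomputable def th (ε r0 s : ℝ) : ℝ := (1 + Real.exp (ε * (s - r0)))⁻¹
noncomputable def hh (ε r0 s : ℝ) : ℝ := ε * (th ε r0 s * (1 - th ε r0 s))
noncomputable def om (b s : ℝ) : ℝ := Real.exp (2 * b * s)
noncomputable def wt (b ε r0 s : ℝ) : ℝ := om b s * th ε r0 s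
noncomputable def dwt (b ε r0 s : ℝ) : ℝ := 2 * b * (om b s * th ε r0 s) - om b s * hh ε r0 s

lemma th_pos (ε r0 s : ℝ) : 0 < th ε r0 s := by unfold th; positivity
lemma th_le_one (ε r0 s : ℝ) : th ε r0 s ≤ 1 := by 
  unfold th; apply inv_le_one_of_one_le₀; linarith [Real.exp_pos (ε * (s - r0))]
lemma th_le_exp (ε r0 s : ℝ) : th ε r0 s ≤ Real.exp (ε * r0) * Real.exp (-ε * s) := by
  unfold th
  rw [← Real.exp_add, show ε * r0 + -ε * s = -(ε * (s - r0)) by ring, Real.exp_neg]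
  apply inv_anti₀ (Real.exp_pos _); linarith
lemma hh_nonneg {ε : ℝ} (hε : 0 ≤ ε) (r0 s : ℝ) : 0 ≤ hh ε r0 s := by
  unfold hh
  have := th_pos ε r0 s; have := th_le_one ε r0 s
  apply mul_nonneg hε (mul_nonneg (by linarith) (by linarith))
lemma hh_le {ε : ℝ} (hε : 0 ≤ ε) (r0 s : ℝ) : hh ε r0 s ≤ ε * th ε r0 s := by
  unfold hh
  have := th_pos ε r0 s
  apply mul_le_mul_of_nonneg_left _ hε
  nlinarith
lemma hh_ge {ε : ℝ} (hε : 0 ≤ ε) (hε1 : ε ≤ 1) {r0 s : ℝ} (h1 : r0 ≤ s) (h2 : s ≤ r0 + 1) : 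
    ε / 8 ≤ hh ε r0 s := by
  have h3 : ε * (s - r0) ≤ 1 := by nlinarith
  have h4 : 0 ≤ ε * (s - r0) := mul_nonneg hε (by linarith)
  have h5 : Real.exp (ε * (s - r0)) ≤ 3 := by
    refine (Real.exp_le_exp.2 h3).trans ?_
    linarith [Real.exp_one_lt_d9]
  have h6 : 1 ≤ Real.exp (ε * (s - r0)) := Real.one_le_exp h4
  have h7 : th ε r0 s ≤ 1/2 := by
    unfold th; rw [inv_le_comm₀ (by positivity) (by norm_num)]; norm_num; linarith
  have h8 : 1/4 ≤ th ε r0 s := by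
    unfold th; rw [le_inv_comm₀ (by norm_num) (by positivity)]; norm_num; linarith
  unfold hh
  have : 1/8 ≤ th ε r0 s * (1 - th ε r0 s) := by nlinarith
  nlinarith
lemma th_deriv (ε r0 s : ℝ) : HasDerivAt (th ε r0) (-hh ε r0 s) s := by
  have h1 : HasDerivAt (fun s => 1 + Real.exp (ε * (s - r0))) (Real.exp (ε * (s - r0)) * (ε * 1)) s :=
    ((((hasDerivAt_id s).sub_const r0).const_mul ε).exp).const_add 1
  have h0 : (1 + Real.exp (ε * (s - r0))) ≠ 0 := by positivity
  refine (h1.inv h0).congr_deriv ?_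
  unfold hh th
  field_simp
  ring
lemma om_pos (b s : ℝ) : 0 < om b s := Real.exp_pos _
lemma om_deriv (b s : ℝ) : HasDerivAt (om b) (2 * b * om b s) s := by
  have h1 : HasDerivAt (om b) (Real.exp (2 * b * s) * (2 * b * 1)) s :=
    ((hasDerivAt_id s).const_mul (2 * b)).exp
  refine h1.congr_deriv ?_
  unfold om; ring
lemma wt_deriv (b ε r0 s : ℝ) : HasDerivAt (wt b ε r0) (dwt b ε r0 s) s := by
  refine ((om_deriv b s).mul (th_deriv ε r0 s)).congr_deriv ?_
  unfold dwt; ring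
lemma wt_nonneg (b ε r0 s : ℝ) : 0 ≤ wt b ε r0 s := (mul_pos (om_pos _ _) (th_pos _ _ _)).le
lemma wt_continuous (b ε r0 : ℝ) : Continuous (wt b ε r0) := 
  continuous_iff_continuousAt.2 fun s => (wt_deriv b ε r0 s).continuousAt
lemma th_continuous (ε r0 : ℝ) : Continuous (th ε r0) := 
  continuous_iff_continuousAt.2 fun s => (th_deriv ε r0 s).continuousAt
lemma om_continuous (b : ℝ) : Continuous (om b) := 
  continuous_iff_continuousAt.2 fun s => (om_deriv b s).continuousAt
lemma hh_continuous (ε r0 : ℝ) : Continuous (hh ε r0) := by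
  have := th_continuous ε r0
  unfold hh; fun_prop
lemma dwt_continuous (b ε r0 : ℝ) : Continuous (dwt b ε r0) := by
  have := th_continuous ε r0
  have := om_continuous b
  have := hh_continuous ε r0
  unfold dwt; fun_prop
lemma wt_le (b ε r0 s : ℝ) : wt b ε r0 s ≤ Real.exp (ε * r0) * Real.exp ((2 * b - ε) * s) := by
  unfold wt om
  calc _ ≤ Real.exp (2 * b * s) * (Real.exp (ε * r0) * Real.exp (-ε * s)) := by
        gcongr; exact th_le_exp _ _ _
    _ = _ := by rw [show (2 * b - ε) * s = 2 * b * s + -ε * s by ring, Real.exp_add]; ring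
lemma omhh_le (b : ℝ) {ε : ℝ} (hε : 0 ≤ ε) (r0 s : ℝ) : om b s * hh ε r0 s ≤ ε * wt b ε r0 s := by
  have := mul_le_mul_of_nonneg_left (hh_le hε r0 s) (om_pos b s).le
  unfold wt; linarith
lemma dwt_abs_le {b ε : ℝ} (hε : 0 ≤ ε) (hb : ε ≤ b) (r0 s : ℝ) : 
    |dwt b ε r0 s| ≤ 2 * b * wt b ε r0 s := by
  have h1 := omhh_le b hε r0 s
  have h2 : 0 ≤ om b s * hh ε r0 s := mul_nonneg (om_pos b s).le (hh_nonneg hε _ _)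
  have h3 := wt_nonneg b ε r0 s
  have : dwt b ε r0 s = 2 * b * wt b ε r0 s - om b s * hh ε r0 s := rfl
  rw [this, abs_le]
  constructor <;> nlinarith

/-! ### Radial derivatives -/

/-- components of the radial unit vector -/
noncomputable def nu (i : Fin 3) (x : E3) : ℝ := ‖x‖⁻¹ * x i

lemma nu_measurable (i : Fin 3) : Measurable (nu i) := by unfold nu; fun_prop

lemma nu_abs_le (i : Fin 3) (x : E3) : |nu i x| ≤ 1 := by
  have := inner_unit_le x i
  rw [Complex.norm_real] at this
  simpa [nu, EuclideanSpace.inner_single_right] using this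

lemma nu_sq {x : E3} (hx : x ≠ 0) : nu 0 x ^ 2 + nu 1 x ^ 2 + nu 2 x ^ 2 = 1 := by
  have h := EuclideanSpace.real_norm_sq_eq x
  rw [Fin.sum_univ_three] at h
  have h0 := norm_ne_zero_iff.2 hx
  unfold nu
  field_simp
  linarith

lemma norm_hasFDerivAt {x : E3} (hx : x ≠ 0) : 
    HasFDerivAt (fun z : E3 => ‖z‖) (‖x‖⁻¹ • innerSL ℝ x) x := by
  have h2 := (hasStrictFDerivAt_norm_sq x).hasFDerivAt.sqrt (pow_ne_zero 2 (norm_ne_zero_iff.2 hx))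
  have h3 : (fun z : E3 => ‖z‖) = fun z => √(‖z‖ ^ 2) := by
    ext z; rw [Real.sqrt_sq (norm_nonneg _)]
  rw [h3]
  refine h2.congr_fderiv ?_
  ext v
  have := norm_ne_zero_iff.2 hx
  rw [Real.sqrt_sq (norm_nonneg _)]
  simp
  field_simp

lemma radial_hasFDerivAt {x : E3} (hx : x ≠ 0) {g : ℝ → ℂ} {g' : ℂ} (hg : HasDerivAt g g' ‖x‖) :
    HasFDerivAt (fun z : E3 => g ‖z‖) ((‖x‖⁻¹ • innerSL ℝ x).smulRight g') x := by
  refine (HasFDerivAt.comp x hg.hasFDerivAt (norm_hasFDerivAt hx)).congr_fderiv ?_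
  ext v
  simp
  ring

lemma conj_hasFDerivAt {u : E3 → ℂ} {L : E3 →L[ℝ] ℂ} {x : E3} (h : HasFDerivAt u L x) :
    HasFDerivAt (fun z => (starRingEnd ℂ) (u z)) ((Complex.conjCLE : ℂ →L[ℝ] ℂ).comp L) x :=
  (Complex.conjCLE : ℂ →L[ℝ] ℂ).hasFDerivAt.comp x h

lemma conj_radial_fderiv {u : E3 → ℂ} {x : E3} (hu : DifferentiableAt ℝ u x) (hx : x ≠ 0) 
    {g : ℝ → ℂ} {g' : ℂ} (hg : HasDerivAt g g' ‖x‖) : 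
    DifferentiableAt ℝ (fun z => (starRingEnd ℂ) (u z) * g ‖z‖) x ∧ ∀ i : Fin 3, 
    fderiv ℝ (fun z => (starRingEnd ℂ) (u z) * g ‖z‖) x (EuclideanSpace.single i 1) = 
      (starRingEnd ℂ) (fderiv ℝ u x (EuclideanSpace.single i 1)) * g ‖x‖ + 
      (starRingEnd ℂ) (u x) * (g' * nu i x) := by
  have h := (conj_hasFDerivAt hu.hasFDerivAt).mul (radial_hasFDerivAt hx hg)
  refine ⟨h.differentiableAt, fun i => ?_⟩
  have h' : fderiv ℝ (fun z => (starRingEnd ℂ) (u z) * g ‖z‖) x = _ := h.fderiv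
  rw [h']
  simp [nu, EuclideanSpace.inner_single_right]
  ring

end

section

open MeasureTheory Metric Filter Topology

/-! ### Integration by parts along rays -/

lemma decay_bound {b ε r0 C r : ℝ} {a c : ℂ} (ha : ‖a‖ ≤ C * Real.exp (-(b - ε/4) * r)) (hC : 0 ≤ C)
    (hc : ‖c‖ ≤ C * Real.exp (-(b - ε/4) * r)) : 
    wt b ε r0 r * (‖a‖ * ‖c‖) ≤ (Real.exp (ε * r0) * C ^ 2) * Real.exp (-(ε/2) * r) := by
  calc _ ≤ (Real.exp (ε * r0) * Real.exp ((2 * b - ε) * r)) * ((C * Real.exp (-(b - ε/4) * r)) * (C * Real.exp (-(b - ε/4) * r))) := by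
        gcongr
        exact wt_le _ _ _ _
    _ = (Real.exp (ε * r0) * C ^ 2) * (Real.exp ((2 * b - ε) * r) * Real.exp (-(b - ε/4) * r) * Real.exp (-(b - ε/4) * r)) := by ring
    _ = _ := by
        rw [← Real.exp_add, ← Real.exp_add]; congr 2; ring


/-- partial derivatives -/
noncomputable def pd (u : E3 → ℂ) (i : Fin 3) (x : E3) : ℂ := fderiv ℝ u x (EuclideanSpace.single i 1)

lemma pd_continuous {u : E3 → ℂ} (hu : ContDiff ℝ 1 u) (i : Fin 3) : Continuous (pd u i) :=
  (hu.continuous_fderiv one_ne_zero).clm_apply continuous_const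

noncomputable def J2 (b ε r0 : ℝ) (u : E3 → ℂ) (x : E3) : ℂ :=
  (‖x‖⁻¹ : ℝ) ^ 2 * (wt b ε r0 ‖x‖ * (u x * (starRingEnd ℂ) (u x))) + 
  (‖x‖⁻¹ : ℝ) * (dwt b ε r0 ‖x‖ * (u x * (starRingEnd ℂ) (u x)) + 
    wt b ε r0 ‖x‖ * ∑ i : Fin 3, nu i x * (pd u i x * (starRingEnd ℂ) (u x) + u x * (starRingEnd ℂ) (pd u i x)))

lemma J2_measurable (b ε r0 : ℝ) {u : E3 → ℂ} (hu : ContDiff ℝ 1 u) : Measurable (J2 b ε r0 u) := by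
  have h1 := (wt_continuous b ε r0).measurable
  have h2 := (dwt_continuous b ε r0).measurable
  have h3 := hu.continuous.measurable
  have h4 := fun i => (pd_continuous hu i).measurable
  have h5 := fun i => nu_measurable i
  have h6 : Measurable (starRingEnd ℂ) := Complex.continuous_conj.measurable
  have h7 := h6.comp h3
  have h8 := fun i => h6.comp (h4 i)
  unfold J2
  refine Measurable.add (Measurable.mul (by fun_prop) (Measurable.mul (by fun_prop) (h3.mul h7))) 
    (Measurable.mul (by fun_prop) (Measurable.add (Measurable.mul (by fun_prop) (h3.mul h7)) 
    (Measurable.mul (by fun_prop) (Finset.measurable_sum _ fun i _ => 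
      Measurable.mul (by fun_prop) (((h4 i).mul h7).add (h3.mul (h8 i)))))))

lemma J2_integrable {b ε r0 C : ℝ} (hε : 0 < ε) (hεb : ε ≤ b) {u : E3 → ℂ} (hu : ContDiff ℝ 1 u) (hC : 0 ≤ C)
    (hb : ∀ x, ‖u x‖ ≤ C * Real.exp (-(b - ε/4) * ‖x‖)) 
    (hb' : ∀ x i, ‖pd u i x‖ ≤ C * Real.exp (-(b - ε/4) * ‖x‖)) : 
    Integrable (J2 b ε r0 u) := by
  set K := Real.exp (ε * r0) * C ^ 2
  have hb0 : 0 < b := hε.trans_le hεb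
  refine ((maj_integrable (half_pos hε)).const_mul (K * (1 + 2 * b + 6))).mono' 
    (J2_measurable b ε r0 hu).aestronglyMeasurable (Eventually.of_forall fun x => ?_)
  set E := Real.exp (-(ε/2) * ‖x‖) with hE
  have d1 : wt b ε r0 ‖x‖ * (‖u x‖ * ‖u x‖) ≤ K * E := decay_bound (hb x) hC (hb x)
  have d2 : ∀ i, wt b ε r0 ‖x‖ * (‖pd u i x‖ * ‖u x‖) ≤ K * E := fun i => decay_bound (hb' x i) hC (hb x)
  have hw := wt_nonneg b ε r0 ‖x‖
  have hx0 : 0 ≤ ‖x‖⁻¹ := by positivity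
  have hxx := inv_le_maj _ hx0
  have a1 : ‖(‖x‖⁻¹ : ℝ) ^ 2 * (wt b ε r0 ‖x‖ * (u x * (starRingEnd ℂ) (u x)))‖ ≤ (‖x‖⁻¹)^2 * (K * E) := by
    rw [norm_mul, norm_pow, norm_mul, norm_mul, Complex.norm_real, Complex.norm_real, RCLike.norm_conj, 
      Real.norm_eq_abs, Real.norm_eq_abs, abs_of_nonneg hw, abs_of_nonneg hx0]
    gcongr
  have a2 : ‖(dwt b ε r0 ‖x‖ * (u x * (starRingEnd ℂ) (u x)) : ℂ)‖ ≤ 2 * b * (K * E) := by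
    rw [norm_mul, norm_mul, Complex.norm_real, RCLike.norm_conj, Real.norm_eq_abs]
    calc _ ≤ (2 * b * wt b ε r0 ‖x‖) * (‖u x‖ * ‖u x‖) := by 
          gcongr; exact dwt_abs_le hε.le hεb _ _
      _ = 2 * b * (wt b ε r0 ‖x‖ * (‖u x‖ * ‖u x‖)) := by ring
      _ ≤ _ := by gcongr
  have a3 : ∀ i, ‖(nu i x * (pd u i x * (starRingEnd ℂ) (u x) + u x * (starRingEnd ℂ) (pd u i x)) : ℂ)‖ ≤ 1 * (2 * (‖pd u i x‖ * ‖u x‖)) := by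
    intro i
    rw [norm_mul, Complex.norm_real, Real.norm_eq_abs]
    gcongr
    · exact nu_abs_le i x
    · refine (norm_add_le _ _).trans (le_of_eq ?_)
      rw [norm_mul, norm_mul, RCLike.norm_conj, RCLike.norm_conj]; ring
  have a4 : ‖(wt b ε r0 ‖x‖ * ∑ i : Fin 3, nu i x * (pd u i x * (starRingEnd ℂ) (u x) + u x * (starRingEnd ℂ) (pd u i x)) : ℂ)‖ ≤ 6 * (K * E) := by
    rw [norm_mul, Complex.norm_real, Real.norm_eq_abs, abs_of_nonneg hw]
    calc _ ≤ wt b ε r0 ‖x‖ * ∑ i : Fin 3, 1 * (2 * (‖pd u i x‖ * ‖u x‖)) := by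
          gcongr
          exact norm_sum_le_of_le _ fun i _ => a3 i
      _ = ∑ i : Fin 3, 2 * (wt b ε r0 ‖x‖ * (‖pd u i x‖ * ‖u x‖)) := by
          rw [Finset.mul_sum]; exact Finset.sum_congr rfl fun i _ => by ring
      _ ≤ ∑ i : Fin 3, 2 * (K * E) := Finset.sum_le_sum fun i _ => by have := d2 i; linarith
      _ = _ := by simp; ring
  have hK : 0 ≤ K * E := by positivity
  calc ‖J2 b ε r0 u x‖ ≤ (‖x‖⁻¹)^2 * (K * E) + ‖x‖⁻¹ * (2 * b * (K * E) + 6 * (K * E)) := by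
        unfold J2
        refine (norm_add_le _ _).trans (add_le_add a1 ?_)
        rw [norm_mul, Complex.norm_real, Real.norm_eq_abs, abs_of_nonneg hx0]
        gcongr
        exact (norm_add_le _ _).trans (add_le_add a2 a4)
    _ ≤ (1 + (‖x‖⁻¹)^2) * (K * E) + (1 + (‖x‖⁻¹)^2) * (2 * b * (K * E) + 6 * (K * E)) := by
        gcongr
        linarith
    _ = K * (1 + 2 * b + 6) * maj (ε/2) x := by
        unfold maj; rw [← hE]; ring

lemma J2_integral {b ε r0 C : ℝ} (hε : 0 < ε) (hεb : ε ≤ b) {u : E3 → ℂ} (hu : ContDiff ℝ 1 u) (hC : 0 ≤ C)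
    (hb : ∀ x, ‖u x‖ ≤ C * Real.exp (-(b - ε/4) * ‖x‖)) 
    (hb' : ∀ x i, ‖pd u i x‖ ≤ C * Real.exp (-(b - ε/4) * ‖x‖)) : 
    ∫ x, J2 b ε r0 u x = 0 := by
  rw [ray_integral _ (J2_integrable hε hεb hu hC hb hb') 0, mul_zero]
  refine Eventually.of_forall fun σ hintg => ?_
  have hσ : ‖(σ : E3)‖ = 1 := by simpa using σ.2
  have hn : ∀ s : ℝ, 0 < s → ‖s • (σ : E3)‖ = s := fun s hs => by
    rw [norm_smul, hσ, mul_one, Real.norm_eq_abs, abs_of_pos hs]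
  set v : ℝ → ℂ := fun s => u (s • (σ : E3)) with hv
  have hvd : ∀ s, HasDerivAt v (∑ i : Fin 3, ((σ : E3) i : ℂ) * pd u i (s • (σ : E3))) s := by
    intro s
    have h1 : HasDerivAt (fun s : ℝ => s • (σ : E3)) ((1 : ℝ) • (σ : E3)) s := (hasDerivAt_id s).smul_const _
    have h2 := (hu.differentiable one_ne_zero (s • (σ : E3))).hasFDerivAt.comp_hasDerivAt s h1
    refine h2.congr_deriv ?_
    rw [one_smul, ← sum_single]
    refine Finset.sum_congr rfl fun i _ => ?_
    simp [EuclideanSpace.inner_single_right, pd]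
  have hvc : ∀ s, HasDerivAt (fun s => (starRingEnd ℂ) (v s)) ((starRingEnd ℂ) (∑ i : Fin 3, ((σ : E3) i : ℂ) * pd u i (s • (σ : E3)))) s := by
    intro s
    have := ((Complex.conjCLE : ℂ →L[ℝ] ℂ).hasFDerivAt (x := v s)).comp_hasDerivAt s (hvd s)
    exact this
  set P : ℝ → ℂ := fun s => (s : ℂ) * ((wt b ε r0 s : ℂ) * (v s * (starRingEnd ℂ) (v s))) with hP
  have hPd : ∀ s ∈ Set.Ioi (0:ℝ), HasDerivAt P ((s^2 : ℝ) • J2 b ε r0 u (s • (σ : E3))) s := by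
    intro s hs
    have hs' : (0:ℝ) < s := hs
    have h1 := (hasDerivAt_id s).ofReal_comp.mul ((wt_deriv b ε r0 s).ofReal_comp.mul ((hvd s).mul (hvc s)))
    refine HasDerivAt.congr_deriv h1 ?_
    have hnu : ∀ i, nu i (s • (σ : E3)) = (σ : E3) i := by
      intro i
      unfold nu; rw [hn s hs']; simp; field_simp
    have hsC : (s : ℂ) ≠ 0 := by exact_mod_cast hs'.ne'
    unfold J2
    simp only [hnu, hn s hs', Complex.real_smul, map_add, map_mul, Complex.conj_ofReal, Fin.sum_univ_three, id, hv, Pi.mul_apply]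
    push_cast
    field_simp
    ring
  have hPb : ∀ s, 0 ≤ s → ‖P s‖ ≤ s * ((Real.exp (ε * r0) * C ^ 2) * Real.exp (-(ε/2) * s)) := by
    intro s hs
    have hns : ‖s • (σ : E3)‖ = s := by rw [norm_smul, hσ, mul_one, Real.norm_eq_abs, abs_of_nonneg hs]
    have := hb (s • (σ : E3))
    rw [hns] at this
    have h2 := decay_bound (r0 := r0) this hC this
    simp only [hP, norm_mul, Complex.norm_real, Real.norm_eq_abs, abs_of_nonneg hs, abs_of_nonneg (wt_nonneg b ε r0 s), RCLike.norm_conj]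
    gcongr
  have hlim : Tendsto P atTop (𝓝 0) := by
    have h1 : Tendsto (fun s : ℝ => (Real.exp (ε * r0) * C ^ 2) * (s ^ 1 * Real.exp (-(ε/2) * s))) atTop (𝓝 ((Real.exp (ε * r0) * C ^ 2) * 0)) := by
      apply Tendsto.const_mul
      have := tendsto_rpow_mul_exp_neg_mul_atTop_nhds_zero 1 (ε/2) (half_pos hε)
      simpa using this
    rw [mul_zero] at h1
    refine squeeze_zero_norm' ?_ h1
    filter_upwards [eventually_ge_atTop 0] with s hs
    refine (hPb s hs).trans (le_of_eq (by ring))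
  have hP0 : P 0 = 0 := by simp [hP]
  have hcont : ContinuousWithinAt P (Set.Ici 0) 0 := by
    have h1 : Continuous v := continuous_iff_continuousAt.2 fun s => (hvd s).continuousAt
    have h2 : Continuous (fun s => (starRingEnd ℂ) (v s)) := continuous_iff_continuousAt.2 fun s => (hvc s).continuousAt
    have h3 := wt_continuous b ε r0
    have : Continuous P := by
      simp only [hP]; fun_prop
    exact this.continuousWithinAt
  rw [integral_Ioi_of_hasDerivAt_of_tendsto hcont hPd hintg hlim, hP0, sub_zero]

end

section

open MeasureTheory Metric Filter Topology


/-! ### The source term -/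

lemma contDiff_of_supp {G : Type*} [NormedAddCommGroup G] [NormedSpace ℝ G] {n : WithTop ℕ∞} 
    {f : E3 → EuclideanSpace ℂ (Fin 3)} (h0 : (0:E3) ∉ tsupport f) {φ : E3 → G}
    (h1 : ∀ x, x ∉ tsupport f → φ =ᶠ[𝓝 x] 0) (h2 : ∀ x, x ≠ 0 → ContDiffAt ℝ n φ x) : ContDiff ℝ n φ := by
  rw [contDiff_iff_contDiffAt]
  intro x
  by_cases hx : x ∈ tsupport f
  · exact h2 x fun h => h0 (h ▸ hx)
  · exact (contDiffAt_const (c := (0:G))).congr_of_eventuallyEq (h1 x hx)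

lemma compact_of_supp {G : Type*} [NormedAddCommGroup G] 
    {f : E3 → EuclideanSpace ℂ (Fin 3)} (hs : HasCompactSupport f) {φ : E3 → G}
    (h1 : ∀ x, x ∉ tsupport f → φ =ᶠ[𝓝 x] 0) : HasCompactSupport φ :=
  HasCompactSupport.intro hs fun x hx => (h1 x hx).eq_of_nhds

/-- component of `f/|y|` -/
noncomputable def Gc (f : E3 → EuclideanSpace ℂ (Fin 3)) (i : Fin 3) (z : E3) : ℂ := (‖z‖⁻¹ • f z) i

noncomputable def Fs (k : ℂ) (f : E3 → EuclideanSpace ℂ (Fin 3)) (y : E3) : ℂ := 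
  Complex.exp (Complex.I * k * ‖y‖) * ‖y‖ * cdiv (fun z => ‖z‖⁻¹ • f z) y

lemma cdiv_eq (f : E3 → EuclideanSpace ℂ (Fin 3)) (y : E3) : 
    cdiv (fun z => ‖z‖⁻¹ • f z) y = ∑ i : Fin 3, fderiv ℝ (Gc f i) y (EuclideanSpace.single i 1) := rfl

section
variable {f : E3 → EuclideanSpace ℂ (Fin 3)}

lemma f_loc {x : E3} (hx : x ∉ tsupport f) : f =ᶠ[𝓝 x] 0 := notMem_tsupport_iff_eventuallyEq.1 hx

lemma Gc_loc {x : E3} (hx : x ∉ tsupport f) (i : Fin 3) : Gc f i =ᶠ[𝓝 x] 0 := by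
  filter_upwards [f_loc hx] with z hz
  simp [Gc, hz]

lemma Gc_contDiff (hf : ContDiff ℝ (⊤ : ℕ∞) f) (h0 : (0:E3) ∉ tsupport f) (i : Fin 3) : ContDiff ℝ 2 (Gc f i) := by
  refine contDiff_of_supp h0 (fun x hx => Gc_loc hx i) fun x hx => ?_
  have h1 : ContDiffAt ℝ 2 f x := by exact_mod_cast (contDiff_infty.1 hf 2).contDiffAt
  have h2 : ContDiffAt ℝ 2 (fun z : E3 => ‖z‖⁻¹ • f z) x := 
    ((contDiffAt_norm ℝ hx).inv (norm_ne_zero_iff.2 hx)).smul h1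
  have h3 : ContDiff ℝ 2 (fun v : EuclideanSpace ℂ (Fin 3) => v i) := 
    ((EuclideanSpace.proj i : EuclideanSpace ℂ (Fin 3) →L[ℂ] ℂ).restrictScalars ℝ).contDiff
  exact h3.contDiffAt.comp x h2

lemma Gc_supp (hs : HasCompactSupport f) (i : Fin 3) : HasCompactSupport (Gc f i) := 
  compact_of_supp hs fun x hx => Gc_loc hx i

lemma Fs_loc (k : ℂ) {x : E3} (hx : x ∉ tsupport f) : Fs k f =ᶠ[𝓝 x] 0 := by
  have h : ∀ᶠ y in 𝓝 x, ∀ i : Fin 3, Gc f i =ᶠ[𝓝 y] 0 := by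
    rw [eventually_all]
    exact fun i => (Gc_loc hx i).eventually_nhds
  filter_upwards [h] with y hy
  have : ∀ i, fderiv ℝ (Gc f i) y = 0 := fun i => by
    rw [(hy i).fderiv_eq]; simp
  simp [Fs, cdiv_eq, this]

lemma Fs_contDiff (k : ℂ) (hf : ContDiff ℝ (⊤ : ℕ∞) f) (h0 : (0:E3) ∉ tsupport f) : ContDiff ℝ 1 (Fs k f) := by
  refine contDiff_of_supp h0 (fun x hx => Fs_loc k hx) fun x hx => ?_
  have h1 : ContDiffAt ℝ 1 (fun z : E3 => (‖z‖ : ℂ)) x := 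
    Complex.ofRealCLM.contDiff.contDiffAt.comp x (contDiffAt_norm ℝ hx)
  have h2 : ContDiff ℝ 1 (fun y => ∑ i : Fin 3, fderiv ℝ (Gc f i) y (EuclideanSpace.single i 1)) := by
    refine ContDiff.sum fun i _ => ?_
    exact ((Gc_contDiff hf h0 i).fderiv_right (m := 1) (by norm_num)).clm_apply contDiff_const
  exact (((contDiffAt_const.mul h1).cexp).mul h1).mul h2.contDiffAt

lemma Fs_supp (k : ℂ) (hs : HasCompactSupport f) : HasCompactSupport (Fs k f) := 
  compact_of_supp hs fun x hx => Fs_loc k hx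

lemma Fs_zero (k : ℂ) : Fs k f 0 = 0 := by simp [Fs]

lemma f_zero (h0 : (0:E3) ∉ tsupport f) : f 0 = 0 := (f_loc h0).eq_of_nhds

end

noncomputable def J3 (k : ℂ) (ε r0 : ℝ) (f : E3 → EuclideanSpace ℂ (Fin 3)) (u : E3 → ℂ) (x : E3) : ℂ :=
  ∑ i : Fin 3, f x i * (Complex.exp (Complex.I * k * ‖x‖) * ((starRingEnd ℂ) (pd u i x) * wt k.im ε r0 ‖x‖ + 
    (starRingEnd ℂ) (u x) * ((dwt k.im ε r0 ‖x‖ + Complex.I * k * wt k.im ε r0 ‖x‖ + wt k.im ε r0 ‖x‖ * (‖x‖⁻¹ : ℝ)) * nu i x)))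

noncomputable def psi (b ε r0 : ℝ) (u : E3 → ℂ) (x : E3) : ℂ := (starRingEnd ℂ) (u x) * (wt b ε r0 ‖x‖ : ℂ)

lemma J3_integral {k : ℂ} {ε r0 : ℝ} {f : E3 → EuclideanSpace ℂ (Fin 3)} {u : E3 → ℂ}
    (hf : ContDiff ℝ (⊤ : ℕ∞) f) (hs : HasCompactSupport f) (h0 : (0:E3) ∉ tsupport f) (hu : ContDiff ℝ 1 u) :
    Integrable (J3 k ε r0 f u) ∧ ∫ x, Fs k f x * psi k.im ε r0 u x = - ∫ x, J3 k ε r0 f u x := by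
  set g : ℝ → ℂ := fun s => Complex.exp (Complex.I * k * s) * s * wt k.im ε r0 s with hg
  set g' : ℝ → ℂ := fun s => (Complex.exp (Complex.I * k * s) * (Complex.I * k) * s + Complex.exp (Complex.I * k * s)) * wt k.im ε r0 s + 
    Complex.exp (Complex.I * k * s) * s * dwt k.im ε r0 s with hg'
  have hgd : ∀ s, HasDerivAt g (g' s) s := by
    intro s
    have h1 : HasDerivAt (fun s : ℝ => (s : ℂ)) 1 s := by simpa using (hasDerivAt_id s).ofReal_comp
    have h2 : HasDerivAt (fun s : ℝ => Complex.exp (Complex.I * k * s)) (Complex.exp (Complex.I * k * s) * (Complex.I * k * 1)) s :=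
      (h1.const_mul (Complex.I * k)).cexp
    refine HasDerivAt.congr_deriv ((h2.mul h1).mul (wt_deriv k.im ε r0 s).ofReal_comp) ?_
    simp [hg']
  set χ : E3 → ℂ := fun z => (starRingEnd ℂ) (u z) * g ‖z‖ with hχ
  have hgc : Continuous g := continuous_iff_continuousAt.2 fun s => (hgd s).continuousAt
  have hcu : Continuous (fun z => (starRingEnd ℂ) (u z)) := Complex.continuous_conj.comp hu.continuous
  have hχc : Continuous χ := hcu.mul (hgc.comp continuous_norm)
  have hdu := hu.differentiable one_ne_zero
  have hG1 := fun i => (Gc_contDiff hf h0 i)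
  have hG0 : ∀ i, Gc f i 0 = 0 := fun i => by simp [Gc]
  have hG' : ∀ i, Continuous (fun x => fderiv ℝ (Gc f i) x (EuclideanSpace.single i 1)) := fun i => 
    ((hG1 i).continuous_fderiv two_ne_zero).clm_apply continuous_const
  have hGs' : ∀ i, HasCompactSupport (fun x => fderiv ℝ (Gc f i) x (EuclideanSpace.single i 1)) := fun i => 
    (Gc_supp hs i).fderiv_apply ℝ _
  have hts : ∀ i x, x ∈ tsupport (Gc f i) → x ≠ 0 := by
    intro i x hx h
    subst h
    exact (notMem_tsupport_iff_eventuallyEq.2 (Gc_loc h0 i)) hx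
  set T : Fin 3 → E3 → ℂ := fun i x => ((starRingEnd ℂ) (pd u i x) * g ‖x‖ + (starRingEnd ℂ) (u x) * (g' ‖x‖ * nu i x)) * Gc f i x with hT
  have hTe : ∀ i x, fderiv ℝ χ x (EuclideanSpace.single i 1) * Gc f i x = T i x := by
    intro i x
    by_cases hx : x = 0
    · simp [hT, hx, hG0]
    · rw [hT]
      simp only
      rw [(conj_radial_fderiv (hdu x) hx (hgd ‖x‖)).2 i]; rfl
  have hTc : ∀ i, Continuous (T i) := by
    intro i
    have hg'c : Continuous g' := by
      have := wt_continuous k.im ε r0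
      have := dwt_continuous k.im ε r0
      simp only [hg']; fun_prop
    rw [continuous_iff_continuousAt]
    intro x
    by_cases hx : x ∈ tsupport (Gc f i)
    · have hx0 := hts i x hx
      have hnu : ContinuousAt (nu i) x := by
        unfold nu
        exact (continuousAt_id.norm.inv₀ (norm_ne_zero_iff.2 hx0)).mul (by fun_prop)
      have h1 := (hgc.comp continuous_norm).continuousAt (x := x)
      have h2 := (hg'c.comp continuous_norm).continuousAt (x := x)
      have h3 := (Complex.continuous_conj.comp (pd_continuous hu i)).continuousAt (x := x)
      exact ((h3.mul h1).add (hcu.continuousAt.mul (h2.mul (Complex.continuous_ofReal.continuousAt.comp hnu)))).mul (hG1 i).continuous.continuousAt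
    · have : T i =ᶠ[𝓝 x] 0 := by
        filter_upwards [notMem_tsupport_iff_eventuallyEq.1 hx] with z hz
        simp [hT, hz]
      exact (continuousAt_const (y := (0:ℂ))).congr this.symm
  have hTi : ∀ i, Integrable (T i) := fun i => (hTc i).integrable_of_hasCompactSupport (Gc_supp hs i).mul_left
  have hJ : J3 k ε r0 f u = fun x => ∑ i, T i x := by
    ext x
    unfold J3
    refine Finset.sum_congr rfl fun i _ => ?_
    by_cases hx : x = 0
    · simp [hT, hx, hG0, f_zero h0]
    · have : (‖x‖ : ℂ) ≠ 0 := by simpa using hx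
      simp only [hT, hg, hg', Gc, PiLp.smul_apply, Complex.real_smul]
      push_cast
      field_simp
      ring
  rw [hJ]
  refine ⟨integrable_finsetSum _ fun i _ => hTi i, ?_⟩
  have h1 : ∀ i, ∫ x, χ x * fderiv ℝ (Gc f i) x (EuclideanSpace.single i 1) = - ∫ x, T i x := by
    intro i
    rw [integral_mul_fderiv_eq_neg_fderiv_mul_of_integrable]
    · simp_rw [hTe]
    · simp_rw [hTe]; exact hTi i
    · exact (hχc.mul (hG' i)).integrable_of_hasCompactSupport (hGs' i).mul_left
    · exact (hχc.mul (hG1 i).continuous).integrable_of_hasCompactSupport (Gc_supp hs i).mul_left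
    · exact fun x hx => (conj_radial_fderiv (hdu x) (hts i x hx) (hgd ‖x‖)).1
    · exact fun x _ => (hG1 i).differentiable two_ne_zero x
  have h2 : ∀ x, Fs k f x * psi k.im ε r0 u x = ∑ i, χ x * fderiv ℝ (Gc f i) x (EuclideanSpace.single i 1) := by
    intro x
    rw [← Finset.mul_sum, ← cdiv_eq]
    simp only [Fs, psi, hχ, hg]
    ring
  simp_rw [h2]
  rw [integral_finsetSum, integral_finsetSum, ← Finset.sum_neg_distrib]
  · exact Finset.sum_congr rfl fun i _ => h1 i
  · exact fun i _ => hTi i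
  · exact fun i _ => (hχc.mul (hG' i)).integrable_of_hasCompactSupport (hGs' i).mul_left

end

section

open MeasureTheory Metric Filter Topology


/-! ### The pointwise inequality -/

lemma cs3 (a : Fin 3 → ℂ) (n : Fin 3 → ℝ) (hn : n 0 ^ 2 + n 1 ^ 2 + n 2 ^ 2 = 1) : 
    ‖∑ i, (n i : ℂ) * a i‖ ^ 2 ≤ ∑ i, ‖a i‖ ^ 2 := by
  have h1 : ‖∑ i, (n i : ℂ) * a i‖ ≤ ∑ i, |n i| * ‖a i‖ := by
    refine norm_sum_le_of_le _ fun i _ => ?_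
    rw [norm_mul, Complex.norm_real, Real.norm_eq_abs]
  have h2 := Finset.sum_mul_sq_le_sq_mul_sq Finset.univ (fun i => |n i|) (fun i => ‖a i‖)
  have h3 : ∑ i, |n i| ^ 2 = 1 := by simp only [sq_abs, Fin.sum_univ_three, hn]
  simp only [h3, one_mul] at h2
  refine le_trans ?_ h2
  gcongr

lemma alg_identity (k u e : ℂ) (d f : Fin 3 → ℂ) (n : Fin 3 → ℝ) (hn : n 0 ^ 2 + n 1 ^ 2 + n 2 ^ 2 = 1)
    (p a c : ℝ) (W : Fin 3 → ℂ) (hW : ∀ i, W i = d i - Complex.I * k * u * n i + u * n i * p)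
    (Q : ℂ) (hQ : Q = ∑ i, (n i : ℂ) * W i) :
    (∑ i, d i * ((starRingEnd ℂ) (d i) * a + (starRingEnd ℂ) u * ((2 * k.im * a - c : ℝ) * n i)) - k ^ 2 * (u * ((starRingEnd ℂ) u * a))) + 
    ((p : ℂ) ^ 2 * (a * (u * (starRingEnd ℂ) u)) + p * ((2 * k.im * a - c : ℝ) * (u * (starRingEnd ℂ) u) + 
      a * ∑ i, n i * (d i * (starRingEnd ℂ) u + u * (starRingEnd ℂ) (d i)))) + 
    (∑ i, f i * (e * ((starRingEnd ℂ) (d i) * a + (starRingEnd ℂ) u * (((2 * k.im * a - c : ℝ) + Complex.I * k * a + a * p) * n i)))) =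
    a * ∑ i, W i * (starRingEnd ℂ) (W i) - c * ((starRingEnd ℂ) u * Q) - Complex.I * k * (c * (u * (starRingEnd ℂ) u)) 
      - Complex.I * k * a * ((starRingEnd ℂ) u * Q - u * (starRingEnd ℂ) Q) + 
      (∑ i, e * (f i * (a * (starRingEnd ℂ) (W i))) - e * ((starRingEnd ℂ) u * (c * ∑ i, n i * f i))) := by
  have hk : (starRingEnd ℂ) k = k - 2 * Complex.I * k.im := by
    apply Complex.ext <;> simp; ring
  have hnC : (n 0 : ℂ) ^ 2 + (n 1 : ℂ) ^ 2 + (n 2 : ℂ) ^ 2 = 1 := by exact_mod_cast hn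
  have hI : Complex.I ^ 2 = -1 := Complex.I_sq
  subst hQ
  simp only [hW, Fin.sum_univ_three, map_add, map_sub, map_mul, Complex.conj_I, Complex.conj_ofReal, hk]
  push_cast
  generalize (n 0 : ℂ) = n0 at *
  generalize (n 1 : ℂ) = n1 at *
  generalize (n 2 : ℂ) = n2 at *
  generalize (starRingEnd ℂ) u = v at *
  generalize (starRingEnd ℂ) (d 0) = d0 at *
  generalize (starRingEnd ℂ) (d 1) = d1 at *
  generalize (starRingEnd ℂ) (d 2) = d2 at *
  generalize (k.im : ℂ) = b at *
  generalize (p : ℂ) = p at *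
  generalize (a : ℂ) = a at *
  generalize (c : ℂ) = c at *
  linear_combination (-(u * v * (a * (p ^ 2 + 2 * b * p - k ^ 2) - c * p + Complex.I * k * c))) * hnC + 
    (-(a * (n0 ^ 2 + n1 ^ 2 + n2 ^ 2) * u * v * (k ^ 2 - 2 * b * p) 
      - 2 * b * a * v * (n0 * (d 0 + e * f 0) + n1 * (d 1 + e * f 1) + n2 * (d 2 + e * f 2)))) * hI

set_option maxHeartbeats 1000000 in
lemma alg_ineq (k u e : ℂ) (d f : Fin 3 → ℂ) (n : Fin 3 → ℝ) (hn : n 0 ^ 2 + n 1 ^ 2 + n 2 ^ 2 = 1)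
    (p ω θ h : ℝ) (hb : 0 < k.im) (hω : 0 < ω) (he : ‖e‖ ^ 2 * ω = 1) (hθ0 : 0 ≤ θ) (hθ1 : θ ≤ 1) 
    (hh0 : 0 ≤ h) (hh1 : h ≤ k.im / 4 * θ) :
    ‖k‖ ^ 2 / 2 * (ω * h * ‖u‖ ^ 2) - (‖k‖ ^ 2 / k.im + k.im) * ∑ i, ‖f i‖ ^ 2 ≤ 
    -((starRingEnd ℂ) k * ((∑ i, d i * ((starRingEnd ℂ) (d i) * (ω * θ : ℝ) + (starRingEnd ℂ) u * ((2 * k.im * (ω * θ) - ω * h : ℝ) * n i)) - k ^ 2 * (u * ((starRingEnd ℂ) u * (ω * θ : ℝ)))) + 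
    ((p : ℂ) ^ 2 * ((ω * θ : ℝ) * (u * (starRingEnd ℂ) u)) + p * ((2 * k.im * (ω * θ) - ω * h : ℝ) * (u * (starRingEnd ℂ) u) + 
      (ω * θ : ℝ) * ∑ i, n i * (d i * (starRingEnd ℂ) u + u * (starRingEnd ℂ) (d i)))) + 
    (∑ i, f i * (e * ((starRingEnd ℂ) (d i) * (ω * θ : ℝ) + (starRingEnd ℂ) u * (((2 * k.im * (ω * θ) - ω * h : ℝ) + Complex.I * k * (ω * θ : ℝ) + (ω * θ : ℝ) * p) * n i)))))).im := by
  set W : Fin 3 → ℂ := fun i => d i - Complex.I * k * u * n i + u * n i * p with hW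
  set Q : ℂ := ∑ i, (n i : ℂ) * W i with hQ
  rw [alg_identity k u e d f n hn p (ω * θ) (ω * h) W (fun i => rfl) Q hQ]
  set b := k.im with hbdef
  set S : ℂ := ∑ i, (n i : ℂ) * f i with hS
  have hQn : ‖Q‖ ^ 2 ≤ ∑ i, ‖W i‖ ^ 2 := cs3 W n hn
  have hSn : ‖S‖ ^ 2 ≤ ∑ i, ‖f i‖ ^ 2 := cs3 f n hn
  have hWW : ∑ i, W i * (starRingEnd ℂ) (W i) = ((∑ i, ‖W i‖ ^ 2 : ℝ) : ℂ) := by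
    push_cast
    exact Finset.sum_congr rfl fun i _ => Complex.mul_conj' _
  have huu : u * (starRingEnd ℂ) u = ((‖u‖ ^ 2 : ℝ) : ℂ) := by push_cast; exact Complex.mul_conj' _
  have hkk : (starRingEnd ℂ) k * k = ((‖k‖ ^ 2 : ℝ) : ℂ) := by rw [mul_comm]; push_cast; exact Complex.mul_conj' _
  have hQQ : (starRingEnd ℂ) u * Q - u * (starRingEnd ℂ) Q = Complex.I * ((2 * ((starRingEnd ℂ) u * Q).im : ℝ) : ℂ) := by
    have : u * (starRingEnd ℂ) Q = (starRingEnd ℂ) ((starRingEnd ℂ) u * Q) := by simp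
    rw [this, Complex.sub_conj]; push_cast; ring
  rw [hWW, huu, hQQ]
  set w := ∑ i, ‖W i‖ ^ 2 with hw
  set ff := ∑ i, ‖f i‖ ^ 2 with hff
  set m := ((starRingEnd ℂ) u * Q).im
  set X : ℂ := (starRingEnd ℂ) k * ((ω * h : ℝ) * ((starRingEnd ℂ) u * Q)) with hX
  set Y1 : Fin 3 → ℂ := fun i => (starRingEnd ℂ) k * (e * (f i * ((ω * θ : ℝ) * (starRingEnd ℂ) (W i)))) with hY1
  set Y2 : ℂ := (starRingEnd ℂ) k * (e * ((starRingEnd ℂ) u * ((ω * h : ℝ) * S))) with hY2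
  have key : (starRingEnd ℂ) k * ((ω * θ : ℝ) * (w : ℂ) - (ω * h : ℝ) * ((starRingEnd ℂ) u * Q) - Complex.I * k * ((ω * h : ℝ) * ((‖u‖ ^ 2 : ℝ) : ℂ)) 
      - Complex.I * k * (ω * θ : ℝ) * (Complex.I * ((2 * m : ℝ) : ℂ)) + 
      (∑ i, e * (f i * ((ω * θ : ℝ) * (starRingEnd ℂ) (W i))) - e * ((starRingEnd ℂ) u * ((ω * h : ℝ) * S)))) = 
      ((ω * θ * w : ℝ) : ℂ) * (starRingEnd ℂ) k - X - Complex.I * ((‖k‖ ^ 2 * (ω * h * ‖u‖ ^ 2) : ℝ) : ℂ) 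
      + ((‖k‖ ^ 2 * (ω * θ) * (2 * m) : ℝ) : ℂ) + (∑ i, Y1 i - Y2) := by
    simp only [hX, hY1, hY2, ← Finset.mul_sum]
    have : ((‖k‖ ^ 2 : ℝ) : ℂ) = (starRingEnd ℂ) k * k := hkk.symm
    push_cast at this ⊢
    rw [this]
    linear_combination (-((starRingEnd ℂ) k * k * (ω * θ) * (2 * m))) * Complex.I_sq
  rw [key]
  have him : (((ω * θ * w : ℝ) : ℂ) * (starRingEnd ℂ) k - X - Complex.I * ((‖k‖ ^ 2 * (ω * h * ‖u‖ ^ 2) : ℝ) : ℂ) 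
      + ((‖k‖ ^ 2 * (ω * θ) * (2 * m) : ℝ) : ℂ) + (∑ i, Y1 i - Y2)).im = 
      -(ω * θ * w * b) - X.im - ‖k‖ ^ 2 * (ω * h * ‖u‖ ^ 2) + (∑ i, Y1 i - Y2).im := by
    simp only [Complex.add_im, Complex.sub_im, Complex.re_ofReal_mul, Complex.im_ofReal_mul, Complex.conj_im, Complex.I_mul_im, Complex.ofReal_re, Complex.ofReal_im]
    ring
  rw [him]
  have hXn : -X.im ≤ ‖X‖ := (neg_le_abs _).trans (Complex.abs_im_le_norm X)
  have hYn : (∑ i, Y1 i - Y2).im ≤ ∑ i, ‖Y1 i‖ + ‖Y2‖ := 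
    (Complex.im_le_norm _).trans ((norm_sub_le _ _).trans (add_le_add (norm_sum_le _ _) le_rfl))
  set κ := ‖k‖ with hκ
  have hκ0 : 0 ≤ κ := norm_nonneg _
  have hωh : 0 ≤ ω * h := by positivity
  have hωθ : 0 ≤ ω * θ := by positivity
  have nX : ‖X‖ ≤ κ ^ 2 / 4 * (ω * h * ‖u‖ ^ 2) + b / 4 * (ω * θ * w) := by
    have : ‖X‖ = κ * (ω * h * (‖u‖ * ‖Q‖)) := by
      simp only [hX, norm_mul, RCLike.norm_conj, Complex.norm_real, Real.norm_eq_abs, abs_of_pos hω, abs_of_nonneg hh0, Complex.ofReal_mul]; ring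
    rw [this]
    have h1 : κ * (‖u‖ * ‖Q‖) ≤ κ ^ 2 / 4 * ‖u‖ ^ 2 + ‖Q‖ ^ 2 := by nlinarith [sq_nonneg (κ * ‖u‖ / 2 - ‖Q‖)]
    have h2 : h * ‖Q‖ ^ 2 ≤ b / 4 * θ * w := by
      calc _ ≤ (b / 4 * θ) * ‖Q‖ ^ 2 := by gcongr
        _ ≤ _ := by gcongr
    have h3 := mul_le_mul_of_nonneg_left h1 hωh
    have h4 := mul_le_mul_of_nonneg_left h2 hω.le
    calc κ * (ω * h * (‖u‖ * ‖Q‖)) = ω * h * (κ * (‖u‖ * ‖Q‖)) := by ring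
      _ ≤ ω * h * (κ ^ 2 / 4 * ‖u‖ ^ 2 + ‖Q‖ ^ 2) := h3
      _ = κ ^ 2 / 4 * (ω * h * ‖u‖ ^ 2) + ω * (h * ‖Q‖ ^ 2) := by ring
      _ ≤ κ ^ 2 / 4 * (ω * h * ‖u‖ ^ 2) + ω * (b / 4 * θ * w) := by linarith
      _ = _ := by ring
  have nY1 : ∀ i, ‖Y1 i‖ ≤ b / 4 * (ω * θ * ‖W i‖ ^ 2) + κ ^ 2 / b * ‖f i‖ ^ 2 := by
    intro i
    have : ‖Y1 i‖ = κ * (‖e‖ * (‖f i‖ * (ω * θ * ‖W i‖))) := by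
      simp only [hY1, norm_mul, RCLike.norm_conj, Complex.norm_real, Real.norm_eq_abs, abs_of_pos hω, abs_of_nonneg hθ0, Complex.ofReal_mul]; rfl
    rw [this]
    have h1 : 0 ≤ (b * ‖W i‖ / 2 - κ * ‖e‖ * ‖f i‖) ^ 2 / b := by positivity
    have h2 : (b * ‖W i‖ / 2 - κ * ‖e‖ * ‖f i‖) ^ 2 / b = b / 4 * ‖W i‖ ^ 2 - κ * ‖e‖ * ‖f i‖ * ‖W i‖ + κ ^ 2 / b * ‖e‖ ^ 2 * ‖f i‖ ^ 2 := by
      field_simp; ring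
    rw [h2] at h1
    have h3 := mul_nonneg hωθ h1
    have h4 : ω * θ * (b / 4 * ‖W i‖ ^ 2 - κ * ‖e‖ * ‖f i‖ * ‖W i‖ + κ ^ 2 / b * ‖e‖ ^ 2 * ‖f i‖ ^ 2) = 
        b / 4 * (ω * θ * ‖W i‖ ^ 2) - κ * (‖e‖ * (‖f i‖ * (ω * θ * ‖W i‖))) + θ * (κ ^ 2 / b * ‖f i‖ ^ 2) := by
      linear_combination (θ * κ ^ 2 / b * ‖f i‖ ^ 2) * he
    have h5 : 0 ≤ κ ^ 2 / b * ‖f i‖ ^ 2 := by positivity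
    have h6 := mul_le_mul_of_nonneg_right hθ1 h5
    linarith
  have nY2 : ‖Y2‖ ≤ κ ^ 2 / 4 * (ω * h * ‖u‖ ^ 2) + b * ff := by
    have : ‖Y2‖ = κ * (‖e‖ * (‖u‖ * (ω * h * ‖S‖))) := by
      simp only [hY2, norm_mul, RCLike.norm_conj, Complex.norm_real, Real.norm_eq_abs, abs_of_pos hω, abs_of_nonneg hh0, Complex.ofReal_mul]; rfl
    rw [this]
    have h3 := mul_nonneg hωh (sq_nonneg (κ * ‖u‖ / 2 - ‖e‖ * ‖S‖))
    have h4 : ω * h * (κ * ‖u‖ / 2 - ‖e‖ * ‖S‖) ^ 2 = 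
      κ ^ 2 / 4 * (ω * h * ‖u‖ ^ 2) - κ * (‖e‖ * (‖u‖ * (ω * h * ‖S‖))) + h * ‖S‖ ^ 2 := by
      linear_combination (h * ‖S‖ ^ 2) * he
    have h5 : h * ‖S‖ ^ 2 ≤ b * ff := by
      have h6 := mul_le_mul_of_nonneg_left hθ1 hb.le
      have h7 : h ≤ b := by linarith
      exact mul_le_mul h7 hSn (by positivity) hb.le
    linarith
  have sY1 : ∑ i, ‖Y1 i‖ ≤ b / 4 * (ω * θ * w) + κ ^ 2 / b * ff := by
    refine (Finset.sum_le_sum fun i _ => nY1 i).trans (le_of_eq ?_)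
    rw [Finset.sum_add_distrib, ← Finset.mul_sum, ← Finset.mul_sum, ← Finset.mul_sum]
  have hw0 : 0 ≤ w := Finset.sum_nonneg fun i _ => by positivity
  have hA : 0 ≤ b * (ω * θ * w) := by positivity
  have : (κ ^ 2 / b + b) * ff = κ ^ 2 / b * ff + b * ff := by ring
  rw [this]
  linarith

end

section

open MeasureTheory Metric Filter Topology


/-! ### The energy estimate -/

noncomputable def J1 (k : ℂ) (ε r0 : ℝ) (u : E3 → ℂ) (x : E3) : ℂ :=
  ∑ i : Fin 3, fderiv ℝ u x (EuclideanSpace.single i 1) * 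
    fderiv ℝ (psi k.im ε r0 u) x (EuclideanSpace.single i 1) - k ^ 2 * (u x * psi k.im ε r0 u x)

lemma psi_fderiv (b ε r0 : ℝ) {u : E3 → ℂ} (hu : ContDiff ℝ 1 u) {x : E3} (hx : x ≠ 0) : 
    DifferentiableAt ℝ (psi b ε r0 u) x ∧ ∀ i : Fin 3, 
    fderiv ℝ (psi b ε r0 u) x (EuclideanSpace.single i 1) = 
      (starRingEnd ℂ) (pd u i x) * (wt b ε r0 ‖x‖ : ℂ) + (starRingEnd ℂ) (u x) * ((dwt b ε r0 ‖x‖ : ℂ) * nu i x) :=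
  conj_radial_fderiv (hu.differentiable one_ne_zero x) hx (g := fun s => (wt b ε r0 s : ℂ)) (wt_deriv b ε r0 ‖x‖).ofReal_comp

lemma psi_continuous (b ε r0 : ℝ) {u : E3 → ℂ} (hu : ContDiff ℝ 1 u) : Continuous (psi b ε r0 u) := 
  (Complex.continuous_conj.comp hu.continuous).mul 
    (Complex.continuous_ofReal.comp ((wt_continuous b ε r0).comp continuous_norm))

lemma wt_decay {b ε r0 C r a : ℝ} (hC : 0 ≤ C) (ha : a ≤ C * Real.exp (-(b - ε/4) * r)) :
    a * wt b ε r0 r ≤ (Real.exp (ε * r0) * C) * Real.exp ((b - 3 * ε / 4) * r) := by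
  calc _ ≤ (C * Real.exp (-(b - ε/4) * r)) * (Real.exp (ε * r0) * Real.exp ((2 * b - ε) * r)) := by
        gcongr
        · exact wt_nonneg _ _ _ _
        · exact wt_le _ _ _ _
    _ = (Real.exp (ε * r0) * C) * (Real.exp (-(b - ε/4) * r) * Real.exp ((2 * b - ε) * r)) := by ring
    _ = _ := by rw [← Real.exp_add]; congr 2; ring

lemma psi_bound {b ε r0 C : ℝ} (hε : 0 < ε) (hεb : ε ≤ b) {u : E3 → ℂ} (hu : ContDiff ℝ 1 u) (hC : 0 ≤ C)
    (hb : ∀ x, ‖u x‖ ≤ C * Real.exp (-(b - ε/4) * ‖x‖)) 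
    (hb' : ∀ x i, ‖pd u i x‖ ≤ C * Real.exp (-(b - ε/4) * ‖x‖)) : 
    ∃ D, 0 ≤ D ∧ ∀ x, ‖psi b ε r0 u x‖ ≤ D * Real.exp ((b - 3 * ε / 4) * ‖x‖) ∧ 
      ∀ i : Fin 3, ‖fderiv ℝ (psi b ε r0 u) x (EuclideanSpace.single i 1)‖ ≤ D * Real.exp ((b - 3 * ε / 4) * ‖x‖) := by
  have hb0 : 0 < b := hε.trans_le hεb
  set K := Real.exp (ε * r0) * C with hK
  have hK0 : 0 ≤ K := by positivity
  set Z := ∑ i : Fin 3, ‖fderiv ℝ (psi b ε r0 u) 0 (EuclideanSpace.single i 1)‖ with hZ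
  have hZ0 : 0 ≤ Z := Finset.sum_nonneg fun i _ => norm_nonneg _
  refine ⟨K * (1 + 2 * b) + Z, by positivity, fun x => ⟨?_, fun i => ?_⟩⟩
  · have h1 := wt_decay (r0 := r0) hC (hb x)
    have h2 : ‖psi b ε r0 u x‖ = ‖u x‖ * wt b ε r0 ‖x‖ := by
      simp [psi, abs_of_nonneg (wt_nonneg b ε r0 ‖x‖)]
    rw [h2]
    refine h1.trans ?_
    gcongr
    nlinarith
  · by_cases hx : x = 0
    · subst hx
      have := Finset.single_le_sum (f := fun i : Fin 3 => ‖fderiv ℝ (psi b ε r0 u) 0 (EuclideanSpace.single i 1)‖) (fun i _ => norm_nonneg _) (Finset.mem_univ i)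
      simp only [norm_zero, mul_zero, Real.exp_zero, mul_one]
      have h3 : 0 ≤ K * (1 + 2 * b) := by positivity
      linarith
    · rw [(psi_fderiv b ε r0 hu hx).2 i]
      have h1 := wt_decay (r0 := r0) hC (hb x)
      have h2 := wt_decay (r0 := r0) hC (hb' x i)
      have h3 : ‖(starRingEnd ℂ) (pd u i x) * (wt b ε r0 ‖x‖ : ℂ)‖ = ‖pd u i x‖ * wt b ε r0 ‖x‖ := by
        simp [abs_of_nonneg (wt_nonneg b ε r0 ‖x‖)]
      have h4 : ‖(starRingEnd ℂ) (u x) * ((dwt b ε r0 ‖x‖ : ℂ) * nu i x)‖ ≤ ‖u x‖ * ((2 * b * wt b ε r0 ‖x‖) * 1) := by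
        rw [norm_mul, norm_mul, RCLike.norm_conj, Complex.norm_real, Complex.norm_real]
        have := wt_nonneg b ε r0 ‖x‖
        gcongr
        · exact dwt_abs_le hε.le hεb _ _
        · exact nu_abs_le i x
      set E := Real.exp ((b - 3 * ε / 4) * ‖x‖)
      have hE : 0 ≤ Z * E := by positivity
      have h5 : ‖u x‖ * ((2 * b * wt b ε r0 ‖x‖) * 1) ≤ 2 * b * (K * E) := by
        calc _ = 2 * b * (‖u x‖ * wt b ε r0 ‖x‖) := by ring
          _ ≤ _ := by gcongr
      refine (norm_add_le _ _).trans ?_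
      rw [h3]
      calc _ ≤ K * E + 2 * b * (K * E) := add_le_add h2 (h4.trans h5)
        _ ≤ K * E + 2 * b * (K * E) + Z * E := by linarith
        _ = _ := by ring

lemma J1_integrable {k : ℂ} {ε r0 C : ℝ} (hε : 0 < ε) (hεb : ε ≤ k.im) {u : E3 → ℂ} (hu : ContDiff ℝ 1 u) (hC : 0 ≤ C)
    (hb : ∀ x, ‖u x‖ ≤ C * Real.exp (-(k.im - ε/4) * ‖x‖)) 
    (hb' : ∀ x i, ‖pd u i x‖ ≤ C * Real.exp (-(k.im - ε/4) * ‖x‖)) : 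
    Integrable (J1 k ε r0 u) := by
  obtain ⟨D, hD0, hD⟩ := psi_bound (r0 := r0) hε hεb hu hC hb hb'
  refine ((maj_integrable (half_pos hε)).const_mul (3 * (C * D) + ‖k‖ ^ 2 * (C * D))).mono' ?_ (Eventually.of_forall fun x => ?_)
  · unfold J1
    refine (Measurable.sub (Finset.measurable_sum _ fun i _ => ?_) ?_).aestronglyMeasurable
    · exact (measurable_fderiv_apply_const ℝ _ _).mul (measurable_fderiv_apply_const ℝ _ _)
    · exact (hu.continuous.measurable.mul (psi_continuous k.im ε r0 hu).measurable).const_mul _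
  · set E := Real.exp (-(ε/2) * ‖x‖) with hE
    have hEE : Real.exp (-(k.im - ε/4) * ‖x‖) * Real.exp ((k.im - 3 * ε / 4) * ‖x‖) = E := by
      rw [← Real.exp_add]; congr 1; ring
    have hp : ∀ a c : ℂ, ‖a‖ ≤ C * Real.exp (-(k.im - ε/4) * ‖x‖) → ‖c‖ ≤ D * Real.exp ((k.im - 3 * ε / 4) * ‖x‖) → 
        ‖a * c‖ ≤ C * D * E := by
      intro a c ha hc
      rw [norm_mul]
      calc _ ≤ (C * Real.exp (-(k.im - ε/4) * ‖x‖)) * (D * Real.exp ((k.im - 3 * ε / 4) * ‖x‖)) := by gcongr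
        _ = C * D * (Real.exp (-(k.im - ε/4) * ‖x‖) * Real.exp ((k.im - 3 * ε / 4) * ‖x‖)) := by ring
        _ = _ := by rw [hEE]
    have h1 : ‖J1 k ε r0 u x‖ ≤ ∑ i : Fin 3, C * D * E + ‖k‖ ^ 2 * (C * D * E) := by
      unfold J1
      refine (norm_sub_le _ _).trans (add_le_add (norm_sum_le_of_le _ fun i _ => hp _ _ (hb' x i) ((hD x).2 i)) ?_)
      rw [norm_mul, norm_pow]
      gcongr
      exact hp _ _ (hb x) (hD x).1
    refine h1.trans ?_
    have h2 : E ≤ maj (ε/2) x := by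
      unfold maj; rw [← hE]
      have : 0 ≤ E * (‖x‖⁻¹)^2 := by positivity
      linarith
    calc _ = (3 * (C * D) + ‖k‖ ^ 2 * (C * D)) * E := by simp; ring
      _ ≤ _ := by gcongr

lemma f_sq_integrable {f : E3 → EuclideanSpace ℂ (Fin 3)} (hf : ContDiff ℝ (⊤ : ℕ∞) f) (hs : HasCompactSupport f) : 
    Integrable (fun x => ‖f x‖ ^ 2) := by
  have := hf.continuous
  refine Continuous.integrable_of_hasCompactSupport (by fun_prop) ?_
  exact hs.norm.comp_left (g := fun t : ℝ => t ^ 2) (by simp)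

lemma energy {k : ℂ} {ε r0 : ℝ} (hε : 0 < ε) (hε4 : ε ≤ k.im / 4) {f : E3 → EuclideanSpace ℂ (Fin 3)} 
    (hf : ContDiff ℝ (⊤ : ℕ∞) f) (hs : HasCompactSupport f) (h0 : (0:E3) ∉ tsupport f) :
    Integrable (fun x => om k.im ‖x‖ * hh ε r0 ‖x‖ * ‖res k (Fs k f) x‖ ^ 2) ∧ 
    ‖k‖ ^ 2 / 2 * ∫ x, om k.im ‖x‖ * hh ε r0 ‖x‖ * ‖res k (Fs k f) x‖ ^ 2 ≤ 
      (‖k‖ ^ 2 / k.im + k.im) * ∫ x, ‖f x‖ ^ 2 := by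
  have hk : 0 < k.im := by linarith
  have hεb : ε ≤ k.im := by linarith
  have hF := Fs_contDiff k hf h0
  have hFs := Fs_supp k hs
  obtain ⟨C, hC, hCb⟩ := res_bound (η := ε / 4) (by linarith) (by linarith) hF hFs (k := k)
  set u := res k (Fs k f) with hu_def
  have hu : ContDiff ℝ 1 u := res_contDiff hk hF hFs
  have hb : ∀ x, ‖u x‖ ≤ C * Real.exp (-(k.im - ε/4) * ‖x‖) := fun x => (hCb x).1
  have hb' : ∀ x i, ‖pd u i x‖ ≤ C * Real.exp (-(k.im - ε/4) * ‖x‖) := fun x i => (hCb x).2 i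
  obtain ⟨D, hD0, hD⟩ := psi_bound (r0 := r0) hε hεb hu hC hb hb'
  have i1 := J1_integrable (r0 := r0) hε hεb hu hC hb hb'
  have i2 := J2_integrable (r0 := r0) hε hεb hu hC hb hb'
  obtain ⟨i3, e3⟩ := J3_integral (k := k) (ε := ε) (r0 := r0) hf hs h0 hu
  have e2 := J2_integral (r0 := r0) hε hεb hu hC hb hb'
  have e1 : ∫ x, J1 k ε r0 u x = ∫ x, Fs k f x * psi k.im ε r0 u x := 
    weak_id hF hFs (Fs_zero k) (psi_continuous k.im ε r0 hu) (fun z hz => (psi_fderiv k.im ε r0 hu hz).1) 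
      (C := D) (c := k.im - 3 * ε / 4) (by linarith) (by linarith) (fun x => (hD x).1) (fun x i => (hD x).2 i)
  have etot : ∫ x, (J1 k ε r0 u x + J2 k.im ε r0 u x + J3 k ε r0 f u x) = 0 := by
    have i12 : Integrable (fun x => J1 k ε r0 u x + J2 k.im ε r0 u x) := i1.add i2
    rw [integral_add i12 i3, integral_add i1 i2, e1, e2, e3]; ring
  have itot : Integrable (fun x => J1 k ε r0 u x + J2 k.im ε r0 u x + J3 k ε r0 f u x) := (i1.add i2).add i3
  have itot' : Integrable (fun x => (starRingEnd ℂ) k * (J1 k ε r0 u x + J2 k.im ε r0 u x + J3 k ε r0 f u x)) := itot.const_mul _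
  have eim : ∫ x, ((starRingEnd ℂ) k * (J1 k ε r0 u x + J2 k.im ε r0 u x + J3 k ε r0 f u x)).im = 0 := by
    have := integral_im (𝕜 := ℂ) itot'
    rw [integral_const_mul, etot, mul_zero] at this
    simpa using this
  have iim : Integrable (fun x => ((starRingEnd ℂ) k * (J1 k ε r0 u x + J2 k.im ε r0 u x + J3 k ε r0 f u x)).im) := itot'.im
  have hpt : ∀ᵐ x : E3, ‖k‖ ^ 2 / 2 * (om k.im ‖x‖ * hh ε r0 ‖x‖ * ‖u x‖ ^ 2) - (‖k‖ ^ 2 / k.im + k.im) * ‖f x‖ ^ 2 ≤ 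
      -((starRingEnd ℂ) k * (J1 k ε r0 u x + J2 k.im ε r0 u x + J3 k ε r0 f u x)).im := by
    have hne : ∀ᵐ z : E3, z ≠ 0 := by rw [ae_iff]; simp
    filter_upwards [hne] with x hx
    rw [EuclideanSpace.norm_sq_eq (f x)]
    unfold J1
    simp only [(psi_fderiv k.im ε r0 hu hx).2]
    refine alg_ineq k (u x) (Complex.exp (Complex.I * k * ‖x‖)) (fun i => pd u i x) (fun i => f x i) (fun i => nu i x) (nu_sq hx) 
      ‖x‖⁻¹ (om k.im ‖x‖) (th ε r0 ‖x‖) (hh ε r0 ‖x‖) hk (om_pos _ _) ?_ (th_pos _ _ _).le (th_le_one _ _ _) (hh_nonneg hε.le _ _) ?_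
    · rw [norm_exp_I, om, sq, ← Real.exp_add, ← Real.exp_add, Real.exp_eq_one_iff]; ring
    · refine (hh_le hε.le _ _).trans ?_
      have := th_pos ε r0 ‖x‖
      gcongr
  have hi : Integrable (fun x => om k.im ‖x‖ * hh ε r0 ‖x‖ * ‖u x‖ ^ 2) := by
    refine ((maj_integrable (half_pos hε)).const_mul (ε * (Real.exp (ε * r0) * C ^ 2))).mono' ?_ (Eventually.of_forall fun x => ?_)
    · have h1 := om_continuous k.im
      have h2 := hh_continuous ε r0
      have h3 := hu.continuous
      exact Continuous.aestronglyMeasurable (by fun_prop)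
    · have h1 := decay_bound (r0 := r0) (hb x) hC (hb x)
      have h2 := omhh_le k.im hε.le r0 ‖x‖
      have h3 : 0 ≤ om k.im ‖x‖ * hh ε r0 ‖x‖ * ‖u x‖ ^ 2 := 
        mul_nonneg (mul_nonneg (om_pos _ _).le (hh_nonneg hε.le _ _)) (by positivity)
      rw [Real.norm_eq_abs, abs_of_nonneg h3]
      have h4 : Real.exp (-(ε/2) * ‖x‖) ≤ maj (ε/2) x := by
        unfold maj
        have : 0 ≤ Real.exp (-(ε/2) * ‖x‖) * (‖x‖⁻¹)^2 := by positivity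
        linarith
      calc _ ≤ (ε * wt k.im ε r0 ‖x‖) * ‖u x‖ ^ 2 := by gcongr
        _ = ε * (wt k.im ε r0 ‖x‖ * (‖u x‖ * ‖u x‖)) := by ring
        _ ≤ ε * (Real.exp (ε * r0) * C ^ 2 * maj (ε/2) x) := by
          refine mul_le_mul_of_nonneg_left (h1.trans ?_) hε.le
          gcongr
        _ = _ := by ring
  refine ⟨hi, ?_⟩
  have hmono := integral_mono_ae ((hi.const_mul (‖k‖ ^ 2 / 2)).sub ((f_sq_integrable hf hs).const_mul (‖k‖ ^ 2 / k.im + k.im))) iim.neg hpt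
  simp only [Pi.neg_apply, Pi.sub_apply] at hmono
  rw [integral_neg, eim, integral_sub (hi.const_mul _) ((f_sq_integrable hf hs).const_mul _), integral_const_mul, integral_const_mul] at hmono
  linarith

end

section

open MeasureTheory Metric Filter Topology

/-! ### Conclusion -/

lemma mu1_eq (k : ℂ) (f : E3 → EuclideanSpace ℂ (Fin 3)) {ρ : ℝ} {σ : E3} (hρ : 0 < ρ) :
    mu1 k f ρ σ = ρ * (Complex.exp (-(Complex.I * k * ρ)) * res k (Fs k f) (ρ • σ)) := by
  unfold mu1 res
  congr 1
  rw [← integral_sub_left_eq_self (fun t => gf k ‖t‖ * Fs k f (ρ • σ - t)) volume (ρ • σ), ← integral_const_mul]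
  refine integral_congr_ae (Eventually.of_forall fun y => ?_)
  simp only [sub_sub_cancel]
  unfold _root_.ker gf Fs
  set A := ‖ρ • σ - y‖
  by_cases hy : y = 0
  · simp [hy]
  have hyC : (‖y‖ : ℂ) ≠ 0 := by simpa using hy
  have he : Complex.exp (Complex.I * k * ((-ρ + A + ‖y‖ : ℝ) : ℂ)) = 
      Complex.exp (-(Complex.I * k * ρ)) * Complex.exp (Complex.I * k * A) * Complex.exp (Complex.I * k * ‖y‖) := by
    rw [← Complex.exp_add, ← Complex.exp_add]; congr 1; push_cast; ring
  rw [he]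
  push_cast
  by_cases hA : (A : ℂ) = 0
  · simp [hA]
  have hpi : (Real.pi : ℂ) ≠ 0 := by exact_mod_cast Real.pi_ne_zero
  field_simp

lemma mu1_norm (k : ℂ) (f : E3 → EuclideanSpace ℂ (Fin 3)) {ρ : ℝ} {σ : E3} (hρ : 0 < ρ) (hσ : ‖σ‖ = 1) :
    ‖mu1 k f ρ σ‖ ^ 2 = ‖ρ • σ‖ ^ 2 * (om k.im ‖ρ • σ‖ * ‖res k (Fs k f) (ρ • σ)‖ ^ 2) := by
  have h1 : ‖ρ • σ‖ = ρ := by rw [norm_smul, hσ, mul_one, Real.norm_eq_abs, abs_of_pos hρ]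
  rw [mu1_eq k f hρ, norm_mul, norm_mul, Complex.norm_real, h1, Real.norm_eq_abs, abs_of_pos hρ, Complex.norm_exp]
  have : (-(Complex.I * k * ρ)).re = k.im * ρ := by simp
  rw [this, om, show 2 * k.im * ρ = k.im * ρ + k.im * ρ by ring, Real.exp_add]
  ring

lemma shell_bound {k : ℂ} (hk : 0 < k.im) {f : E3 → EuclideanSpace ℂ (Fin 3)} 
    (hf : ContDiff ℝ (⊤ : ℕ∞) f) (hs : HasCompactSupport f) (h0 : (0:E3) ∉ tsupport f) (r : ℝ) :
    ∫⁻ x in {x : E3 | r ≤ ‖x‖ ∧ ‖x‖ ≤ r + 1}, ENNReal.ofReal (om k.im ‖x‖ * ‖res k (Fs k f) x‖ ^ 2) ≤ 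
      ENNReal.ofReal (128 * (1 / k.im ^ 2 + 1 / k.im) * ∫ x, ‖f x‖ ^ 2) := by
  set b := k.im with hb
  set ε := min (b / 4) 1 with hεd
  have hε : 0 < ε := lt_min (by linarith) one_pos
  have hε1 : ε ≤ 1 := min_le_right _ _
  have hε4 : ε ≤ b / 4 := min_le_left _ _
  obtain ⟨hi, he⟩ := energy (r0 := r) hε hε4 hf hs h0
  set u := res k (Fs k f)
  set N := ∫ x, ‖f x‖ ^ 2 with hN
  have hN0 : 0 ≤ N := integral_nonneg fun x => by positivity
  set P := ∫ x, om k.im ‖x‖ * hh ε r ‖x‖ * ‖u x‖ ^ 2 with hP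
  have hnn : ∀ x, 0 ≤ om k.im ‖x‖ * hh ε r ‖x‖ * ‖u x‖ ^ 2 := fun x => 
    mul_nonneg (mul_nonneg (om_pos _ _).le (hh_nonneg hε.le _ _)) (by positivity)
  have hbk : b ≤ ‖k‖ := (le_abs_self _).trans (Complex.abs_im_le_norm k)
  have hk0 : 0 < ‖k‖ := hk.trans_le hbk
  have hP4 : P ≤ 4 / b * N := by
    have h1 : (‖k‖ ^ 2 / b + b) ≤ 2 * ‖k‖ ^ 2 / b := by
      rw [le_div_iff₀ hk, add_mul, div_mul_cancel₀ _ hk.ne']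
      nlinarith
    have h2 : ‖k‖ ^ 2 / 2 * P ≤ 2 * ‖k‖ ^ 2 / b * N := he.trans (by gcongr)
    have h3 : 2 * ‖k‖ ^ 2 / b * N = ‖k‖ ^ 2 / 2 * (4 / b * N) := by field_simp; ring
    rw [h3] at h2
    exact le_of_mul_le_mul_left h2 (by positivity)
  have hεi : 1 / ε ≤ 4 / b + 1 := by
    rcases min_choice (b / 4) 1 with h | h
    · rw [hεd, h, one_div_div]; linarith
    · rw [hεd, h]
      have : 0 < 4 / b := by positivity
      linarith
  calc _ ≤ ∫⁻ x in {x : E3 | r ≤ ‖x‖ ∧ ‖x‖ ≤ r + 1}, ENNReal.ofReal (8 / ε) * ENNReal.ofReal (om k.im ‖x‖ * hh ε r ‖x‖ * ‖u x‖ ^ 2) := by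
        refine setLIntegral_mono' ?_ fun x hx => ?_
        · exact (measurableSet_le measurable_const measurable_norm).inter (measurableSet_le measurable_norm measurable_const)
        · rw [← ENNReal.ofReal_mul (by positivity)]
          apply ENNReal.ofReal_le_ofReal
          have hge := hh_ge hε.le hε1 hx.1 hx.2
          have h5 : 1 ≤ 8 / ε * hh ε r ‖x‖ := by
            rw [div_mul_eq_mul_div, le_div_iff₀ hε]; linarith
          have h6 : 0 ≤ om b ‖x‖ * ‖u x‖ ^ 2 := mul_nonneg (om_pos _ _).le (by positivity)
          calc om b ‖x‖ * ‖u x‖ ^ 2 = 1 * (om b ‖x‖ * ‖u x‖ ^ 2) := by ring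
            _ ≤ (8 / ε * hh ε r ‖x‖) * (om b ‖x‖ * ‖u x‖ ^ 2) := by gcongr
            _ = _ := by ring
    _ ≤ ∫⁻ x : E3, ENNReal.ofReal (8 / ε) * ENNReal.ofReal (om k.im ‖x‖ * hh ε r ‖x‖ * ‖u x‖ ^ 2) := 
        setLIntegral_le_lintegral _ _
    _ = ENNReal.ofReal (8 / ε) * ENNReal.ofReal P := by
        rw [lintegral_const_mul' _ _ ENNReal.ofReal_ne_top, ofReal_integral_eq_lintegral_ofReal hi (Eventually.of_forall hnn)]
    _ = ENNReal.ofReal (8 / ε * P) := (ENNReal.ofReal_mul (by positivity)).symm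
    _ ≤ _ := by
        apply ENNReal.ofReal_le_ofReal
        calc 8 / ε * P = 8 * (1 / ε) * P := by ring
          _ ≤ 8 * (4 / b + 1) * (4 / b * N) := by
            have : 0 ≤ P := integral_nonneg hnn
            gcongr
          _ = (128 * (1 / b ^ 2) + 32 * (1 / b)) * N := by field_simp; ring
          _ ≤ _ := by
            gcongr
            have : 0 < 1 / b := by positivity
            linarith

theorem main_bound (k : ℂ) (hk : 0 < k.im) (f : E3 → EuclideanSpace ℂ (Fin 3)) 
    (hf : ContDiff ℝ (⊤ : ℕ∞) f) (hs : HasCompactSupport f) (h0 : (0:E3) ∉ tsupport f) (r : ℝ) (hr : 0 < r) :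
    (∫ ρ in r..(r + 1), ∫ σ in sphere (0 : E3) 1, ‖mu1 k f ρ σ‖ ^ 2 ∂μH[2]) ≤ 
      (6 * (16 * 192) * 128) * (1 / ‖k‖ ^ 2 + 1 / k.im ^ 2 + 1 / k.im) * (∫ y, ‖f y‖ ^ 2) := by
  set N := ∫ x, ‖f x‖ ^ 2 with hN
  have hN0 : 0 ≤ N := integral_nonneg fun x => by positivity
  have hF := Fs_contDiff k hf h0
  have hu : Continuous (res k (Fs k f)) := (res_contDiff hk hF (Fs_supp k hs)).continuous
  set w : E3 → ℝ := fun x => om k.im ‖x‖ * ‖res k (Fs k f) x‖ ^ 2 with hw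
  have hw0 : ∀ x, 0 ≤ w x := fun x => mul_nonneg (om_pos _ _).le (by positivity)
  have hwc : Continuous w := by
    have := om_continuous k.im
    simp only [hw]; fun_prop
  set q : E3 → ENNReal := fun x => ENNReal.ofReal (‖x‖ ^ 2 * w x) with hq
  have hqm : Measurable q := by
    have : Continuous (fun x : E3 => ‖x‖ ^ 2 * w x) := by fun_prop
    exact this.measurable.ennreal_ofReal
  have step1 : ENNReal.ofReal (∫ ρ in r..(r + 1), ∫ σ in sphere (0 : E3) 1, ‖mu1 k f ρ σ‖ ^ 2 ∂μH[2]) ≤ 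
      ∫⁻ ρ in Set.Ioc r (r+1), ∫⁻ σ in sphere (0 : E3) 1, q (ρ • σ) ∂μH[2] := by
    rw [intervalIntegral.integral_of_le (by linarith)]
    refine (ENNReal.ofReal_le_ofReal (Real.le_norm_self _)).trans ?_
    rw [ofReal_norm]
    refine (enorm_integral_le_lintegral_enorm _).trans ?_
    refine setLIntegral_mono' measurableSet_Ioc fun ρ hρ => ?_
    refine (enorm_integral_le_lintegral_enorm _).trans ?_
    refine setLIntegral_mono' isClosed_sphere.measurableSet fun σ hσ => ?_
    have hρ0 : 0 < ρ := hr.trans hρ.1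
    rw [mu1_norm k f hρ0 (by simpa using hσ), ← ofReal_norm, Real.norm_eq_abs, abs_of_nonneg (mul_nonneg (by positivity) (hw0 _))]
  have step2 := final_polar q hqm r hr
  have step3 : ∫⁻ x in {x : E3 | r ≤ ‖x‖ ∧ ‖x‖ ≤ r + 1}, (ENNReal.ofReal (‖x‖ ^ 2))⁻¹ * q x ≤ 
      ENNReal.ofReal (128 * (1 / k.im ^ 2 + 1 / k.im) * N) := by
    refine le_trans ?_ (shell_bound hk hf hs h0 r)
    refine setLIntegral_mono' ?_ fun x hx => ?_
    · exact (measurableSet_le measurable_const measurable_norm).inter (measurableSet_le measurable_norm measurable_const)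
    · have hx0 : 0 < ‖x‖ := hr.trans_le hx.1
      rw [hq]
      simp only
      rw [ENNReal.ofReal_mul (by positivity), ← mul_assoc, ENNReal.inv_mul_cancel, one_mul]
      · simpa using hx0
      · exact ENNReal.ofReal_ne_top
  have h4 := step1.trans (step2.trans (mul_le_mul_right step3 _))
  have h5 : (6 * (16 * 192) : ENNReal) = ENNReal.ofReal (6 * (16 * 192)) := by
    rw [show (6 * (16 * 192) : ℝ) = ((6 * (16 * 192) : ℕ) : ℝ) by norm_num, ENNReal.ofReal_natCast]; norm_num
  rw [h5, ← ENNReal.ofReal_mul (by norm_num), ENNReal.ofReal_le_ofReal_iff (by positivity)] at h4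
  refine h4.trans ?_
  have h6 : 0 ≤ 1 / ‖k‖ ^ 2 := by positivity
  calc _ = (6 * (16 * 192) * 128) * (1 / k.im ^ 2 + 1 / k.im) * N := by ring
    _ ≤ _ := by
      gcongr
      linarith

end

/-- Uniform-in-`r` bound for `∫_r^{r+1} ‖μ₁(ρ,·)‖²_{L²(S²)} dρ` in terms
of `‖f‖²_{L²(ℝ³)}`, for `k ∈ ℂ⁺` and `f ∈ C_c^∞(ℝ³∖{0}; ℂ³)`. -/
theorem stmt_6 :
    ∃ C : ℝ, 0 < C ∧
      ∀ k : ℂ, 0 < k.im →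
        ∀ f : EuclideanSpace ℝ (Fin 3) → EuclideanSpace ℂ (Fin 3),
          ContDiff ℝ (⊤ : ℕ∞) f → HasCompactSupport f →
          (0 : EuclideanSpace ℝ (Fin 3)) ∉ tsupport f →
          ∀ r : ℝ, 0 < r →
            (∫ ρ in r..(r + 1), ∫ σ in sphere (0 : EuclideanSpace ℝ (Fin 3)) 1,
                ‖mu1 k f ρ σ‖ ^ 2 ∂μH[2]) ≤
              C * (1 / ‖k‖ ^ 2 + 1 / k.im ^ 2 + 1 / k.im) *
                (∫ y : EuclideanSpace ℝ (Fin 3), ‖f y‖ ^ 2) := by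
  exact ⟨6 * (16 * 192) * 128, by norm_num,
    fun k hk f hf hs h0 r hr => main_bound k hk f hf hs h0 r hr⟩
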